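/- arXiv:2404.06263 — 2 statements merged into one kernel-verified Lean document; each statement's English description precedes it below -/
import Mathlib

section
/- Let n ≥ 3. Taking GL_n(ℤ)-invariants is exact on finite-dimensional ℚ-linear representations: for every surjective GL_n(ℤ)-equivariant linear map f : V → W of finite-dimensional ℚ-representations of GL_n(ℤ), the restriction f : V^{GL_n(ℤ)} → W^{GL_n(ℤ)} is surjective. -/
open Polynomial in
/-- `F` is a polynomial function with constant coefficient `c0` and linear coefficient `c1`. -/
def PolyFun {A : Type*} [Ring A] (F : ℕ → A) (c0 c1 : A) : Prop :=
  ∃ p : A[X], (∀ t : ℕ, F t = p.eval (t : A)) ∧ p.coeff 0 = c0 ∧ p.coeff 1 = c1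

section PF
open Polynomial
variable {A : Type*} [Ring A]

lemma PolyFun.mul {F G : ℕ → A} {c0 c1 d0 d1 : A} (h : PolyFun F c0 c1) (k : PolyFun G d0 d1) :
    PolyFun (fun t => F t * G t) (c0 * d0) (c0 * d1 + c1 * d0) := by
  obtain ⟨p, hp, rfl, rfl⟩ := h
  obtain ⟨q, hq, rfl, rfl⟩ := k
  refine ⟨p * q, fun t => ?_, ?_, ?_⟩
  · simp only [hp, hq, eval]
    rw [eval₂_mul_noncomm]
    intro k
    simpa using (Nat.cast_commute t (q.coeff k)).symm
  · simp [mul_coeff_zero]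
  · rw [mul_coeff_one]

lemma PolyFun.const (c : A) : PolyFun (fun _ => c) c 0 :=
  ⟨C c, by simp, by simp, by simp⟩

lemma PolyFun.pow {F : ℕ → A} {c1 : A} (h : PolyFun F 1 c1) (k : ℕ) :
    PolyFun (fun t => F t ^ k) 1 (k * c1) := by
  induction k with
  | zero => simpa using PolyFun.const (1 : A)
  | succ k ih =>
    have := ih.mul h
    simpa [pow_succ, add_mul, add_comm] using this

lemma poly_zero_of_nat [Algebra ℚ A] (p : A[X]) (h : ∀ t : ℕ, p.eval (t : A) = 0) : p = 0 := by
  ext i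
  rw [coeff_zero, ← Module.forall_dual_apply_eq_zero_iff ℚ]
  intro l
  let q : ℚ[X] := ∑ i ∈ Finset.range (p.natDegree + 1), monomial i (l (p.coeff i))
  have hq : q = 0 := by
    apply Polynomial.eq_zero_of_infinite_isRoot
    apply Set.Infinite.mono (s := Set.range (fun t : ℕ => (t : ℚ)))
    · rintro _ ⟨t, rfl⟩
      have := congrArg l (h t)
      rw [eval_eq_sum_range, map_zero, map_sum] at this
      show q.eval _ = 0
      rw [← this, eval_finsetSum]
      refine Finset.sum_congr rfl fun i _ => ?_
      rw [eval_monomial]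
      have : p.coeff i * (t : A) ^ i = ((t : ℚ) ^ i) • p.coeff i := by
        rw [Algebra.smul_def, map_pow, map_natCast, ← Nat.cast_pow, ← Nat.cast_comm]
      rw [this, map_smul, smul_eq_mul, mul_comm]
    · exact Set.infinite_range_of_injective Nat.cast_injective
  have h2 : q.coeff i = 0 := by rw [hq, coeff_zero]
  by_cases hi : i < p.natDegree + 1
  · rw [finsetSum_coeff, Finset.sum_eq_single i] at h2
    · simpa using h2
    · intro b _ hb; rw [coeff_monomial, if_neg hb]
    · intro h'; simp at h'; omega
  · rw [coeff_eq_zero_of_natDegree_lt (by omega), map_zero]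

lemma PolyFun.unique [Algebra ℚ A] {F : ℕ → A} {c0 c1 d0 d1 : A} (h : PolyFun F c0 c1)
    (k : PolyFun F d0 d1) : c1 = d1 := by
  obtain ⟨p, hp, rfl, rfl⟩ := h
  obtain ⟨q, hq, rfl, rfl⟩ := k
  have : p - q = 0 := poly_zero_of_nat _ fun t => by rw [eval_sub, ← hp, ← hq, sub_self]
  rw [sub_eq_zero.mp this]

lemma PolyFun.log_comm [Algebra ℚ A] {T S R X Y Z : A} (m : ℕ)
    (hT : PolyFun (fun t => T ^ t) 1 X) (hS : PolyFun (fun t => S ^ t) 1 Y)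
    (hR : PolyFun (fun t => R ^ t) 1 Z)
    (h : ∀ a b : ℕ, T ^ a * S ^ b = R ^ (m * a * b) * S ^ b * T ^ a) :
    X * Y = m * Z + Y * X := by
  have h1 : ∀ b : ℕ, X * S ^ b = (m * b : ℕ) * Z * S ^ b + S ^ b * X := by
    intro b
    have e1 := hT.mul (PolyFun.const (S ^ b))
    have e2 := ((hR.pow (m * b)).mul (PolyFun.const (S ^ b))).mul hT
    have : (fun a : ℕ => (R ^ a) ^ (m * b) * S ^ b * T ^ a) = fun a => T ^ a * S ^ b := by
      funext a
      rw [h, ← pow_mul]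
      congr 3; ring
    rw [this] at e2
    have := e1.unique e2
    simpa [add_comm] using this
  have hlin : PolyFun (fun b : ℕ => ((m * b : ℕ) : A) * Z) 0 (m * Z) := by
    refine ⟨C (m * Z) * Polynomial.X, fun t => ?_, by simp, by simp⟩
    simp only [eval_C_mul, eval_X]
    push_cast
    rw [mul_assoc, mul_assoc, (Nat.cast_commute t Z).eq]
  have e3 : PolyFun (fun b : ℕ => (m * b : ℕ) * Z * S ^ b + S ^ b * X) (0 * 1 + 1 * X)
     ((0 * Y + m * Z * 1) + (1 * 0 + Y * X)) := by
    obtain ⟨p, hp, hp0, hp1⟩ := hlin.mul hS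
    obtain ⟨q, hq, hq0, hq1⟩ := hS.mul (PolyFun.const X)
    exact ⟨p + q, fun t => by rw [eval_add, ← hp, ← hq], by rw [coeff_add, hp0, hq0],
      by rw [coeff_add, hp1, hq1]⟩
  have e4 := (PolyFun.const X).mul hS
  have : (fun t : ℕ => X * S ^ t) = (fun b : ℕ => (m * b : ℕ) * Z * S ^ b + S ^ b * X) :=
    funext h1
  rw [this] at e4
  simpa using e4.unique e3

/-- The binomial polynomial. -/
noncomputable def binPoly (k : ℕ) : ℚ[X] := C ((k.factorial : ℚ)⁻¹) * descPochhammer ℚ k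

lemma binPoly_eval (k t : ℕ) : (binPoly k).eval (t : ℚ) = (t.choose k : ℚ) := by
  rw [binPoly, eval_mul, eval_C, descPochhammer_eval_eq_descFactorial,
    Nat.descFactorial_eq_factorial_mul_choose]
  push_cast
  field_simp

lemma PolyFun.exists_log [Algebra ℚ A] (N : A) (hN : IsNilpotent N) :
    ∃ r : ℚ[X], PolyFun (fun t => (1 + N) ^ t) 1 (N + N * N * aeval N r) := by
  obtain ⟨K, hK⟩ := hN
  have key : PolyFun (fun t => (1 + N) ^ t) 1
      (∑ k ∈ Finset.range (K + 2), (binPoly k).coeff 1 • N ^ k) := by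
    refine ⟨∑ k ∈ Finset.range (K + 2), (binPoly k).map (algebraMap ℚ A) * C (N ^ k), ?_, ?_, ?_⟩
    · intro t
      show (1 + N) ^ t = _
      rw [add_comm, (Commute.one_right N).add_pow, eval_finsetSum]
      have h1 : ∀ k, eval (t : A) ((binPoly k).map (algebraMap ℚ A) * C (N ^ k))
          = N ^ k * (t.choose k : ℕ) := by
        intro k
        rw [eval, eval₂_mul_noncomm]
        · rw [eval₂_C, ← eval, RingHom.id_apply]
          have : (t : A) = algebraMap ℚ A t := by simp
          rw [this, eval_map_algebraMap, aeval_algebraMap_apply_eq_algebraMap_eval, binPoly_eval, map_natCast,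
            Nat.cast_comm]
        · intro i
          simpa using (Nat.cast_commute t _).symm
      simp only [h1, one_pow, mul_one]
      have e1 := Finset.sum_subset (f := fun k => N ^ k * ((t.choose k : ℕ) : A))
        (Finset.range_mono (by omega : t + 1 ≤ max (t + 1) (K + 2)))
        (by
          intro x _ hx
          simp only [Finset.mem_range, not_lt] at hx
          rw [Nat.choose_eq_zero_of_lt (by omega)]; simp)
      have e2 := Finset.sum_subset (f := fun k => N ^ k * ((t.choose k : ℕ) : A))
        (Finset.range_mono (by omega : K + 2 ≤ max (t + 1) (K + 2)))
        (by
          intro x _ hx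
          simp only [Finset.mem_range, not_lt] at hx
          rw [pow_eq_zero_of_le (by omega) hK, zero_mul])
      exact e1.trans e2.symm
    · rw [finsetSum_coeff, Finset.sum_eq_single 0]
      · simp [binPoly]
      · intro k _ hk
        rw [coeff_mul_C, coeff_map, coeff_zero_eq_eval_zero]
        have := binPoly_eval k 0
        rw [Nat.cast_zero] at this
        rw [this, Nat.choose_eq_zero_of_lt (by omega)]; simp
      · simp
    · rw [finsetSum_coeff]
      refine Finset.sum_congr rfl fun k _ => ?_
      rw [coeff_mul_C, coeff_map, Algebra.smul_def]
  refine ⟨∑ k ∈ Finset.range K, C ((binPoly (k + 2)).coeff 1) * X ^ k, ?_⟩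
  convert key using 1
  rw [Finset.sum_range_succ', Finset.sum_range_succ', map_sum, Finset.mul_sum]
  simp only [map_mul, aeval_C, map_pow, aeval_X]
  have h0 : (binPoly 0).coeff 1 = 0 := by simp [binPoly, coeff_one]
  have h1 : (binPoly (0 + 1)).coeff 1 = 1 := by simp [binPoly]
  rw [h0, h1]
  simp only [zero_smul, add_zero, one_smul, zero_add, pow_one]
  rw [add_comm]
  congr 1
  refine Finset.sum_congr rfl fun k _ => ?_
  rw [← Algebra.smul_def, mul_smul_comm, ← pow_two, ← pow_add, add_comm 2]

end PF


section SL2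
open Polynomial Module

variable {M : Type*} [AddCommGroup M] [Module ℚ M]

lemma sl2_ef_pow {A : Type*} [Ring A] {e f h : A} (h1 : e * f - f * e = h)
    (h3 : h * f - f * h = -(2 * f)) (k : ℕ) :
    e * f ^ (k + 1) = f ^ (k + 1) * e + (k + 1 : ℕ) * (f ^ k * (h - k)) := by
  have h1' : e * f = f * e + h := by rw [← h1]; abel
  have h3' : h * f = f * h - 2 * f := by rw [sub_eq_add_neg, ← h3]; abel
  induction k with
  | zero => simpa using h1'
  | succ k ih =>
    have c1 := (Nat.cast_commute k f).eq
    have c2 := (Nat.cast_commute k (f ^ k)).eq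
    have c3 := (Nat.cast_commute k (f ^ (k+1))).eq
    have c4 := (Commute.ofNat_left 2 (f ^ k)).eq
    calc e * f ^ (k + 1 + 1) = (e * f ^ (k + 1)) * f := by rw [pow_succ f (k + 1), mul_assoc]
      _ = f ^ (k + 1) * (e * f) + (k + 1 : ℕ) * (f ^ k * (h * f - k * f)) := by
        rw [ih]; noncomm_ring
      _ = f ^ (k + 1) * (f * e + h) + (k + 1 : ℕ) * (f ^ k * (f * h - 2 * f - f * k)) := by
        rw [h1', h3', c1]
      _ = f ^ (k + 1) * (f * e + h) +
        (k + 1 : ℕ) * (f ^ (k + 1) * (h - 2 - k)) := by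
        have : f * h - 2 * f - f * k = f * (h - 2 - k) := by
          rw [mul_sub, mul_sub, (Commute.ofNat_left 2 f).eq]
        rw [this, ← mul_assoc (f ^ k), pow_succ]
      _ = f ^ (k + 1 + 1) * e + (k + 1 + 1 : ℕ) * (f ^ (k + 1) * (h - (k + 1 : ℕ))) := by
        push_cast
        have : f ^ (k + 1 + 1) = f ^ (k + 1) * f := pow_succ _ _
        rw [this]
        simp only [mul_add, add_mul, mul_sub, one_mul, mul_one, ← mul_assoc, c3]
        have c5 : (2 : A) = 1 + 1 := by norm_num
        rw [c5]
        simp only [mul_add, add_mul, mul_one, mul_assoc]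
        abel

lemma sl2_ker {e f h : End ℚ M} (h1 : e * f - f * e = h) (h2 : h * e - e * h = 2 * e)
    (h3 : h * f - f * h = -(2 * f)) (k : ℕ) : ∀ v : M, e v = 0 →
    (e ^ k) ((f ^ k) v) = (k.factorial : ℚ) •
      aeval h (∏ i ∈ Finset.range k, (X - C (i : ℚ))) v := by
  induction k with
  | zero => intro v _; simp
  | succ k ih =>
    intro v hv
    have e1 : e ((f ^ (k + 1)) v) = ((k + 1 : ℕ) : ℚ) • (f ^ k) (h v - (k : ℚ) • v) := by
      have := congrArg (fun g : End ℚ M => g v) (sl2_ef_pow h1 h3 k)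
      simp only [End.mul_apply, LinearMap.add_apply, hv, map_zero, zero_add] at this
      rw [this]
      rw [Module.End.natCast_apply, LinearMap.sub_apply, Module.End.natCast_apply]
      simp only [Nat.cast_smul_eq_nsmul]
    have hu : e (h v - (k : ℚ) • v) = 0 := by
      have := congrArg (fun g : End ℚ M => g v) h2
      simp only [End.mul_apply, LinearMap.sub_apply, hv, map_zero, zero_sub] at this
      rw [map_sub, map_smul, hv, smul_zero, sub_zero]
      simpa using this
    rw [pow_succ e, End.mul_apply, e1, map_smul, ih _ hu, smul_smul, Finset.prod_range_succ,
      map_mul, End.mul_apply, Nat.factorial_succ, Nat.cast_mul]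
    congr 2
    simp [Nat.cast_smul_eq_nsmul]

lemma sl2_shift {e h : End ℚ M} (h2 : h * e - e * h = 2 * e) (j : ℕ) (p : ℚ[X]) :
    aeval h p * e ^ j = e ^ j * aeval h (p.comp (X + C (2 * j : ℚ))) := by
  have key : h * e ^ j = e ^ j * (h + algebraMap ℚ _ (2 * j : ℚ)) := by
    induction j with
    | zero => simp
    | succ j ih =>
      have h2' : h * e = e * h + 2 * e := by rw [← h2]; abel
      have a1 : algebraMap ℚ (End ℚ M) (2 * ((j + 1 : ℕ) : ℚ)) =
        algebraMap ℚ (End ℚ M) (2 * (j : ℚ)) + 2 := by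
        rw [Nat.cast_succ, mul_add, map_add, mul_one, map_ofNat]
      have c := (Algebra.commutes (2 * (j : ℚ)) e)
      have c' : 2 * e = e * 2 := (Commute.ofNat_left 2 e).eq
      rw [pow_succ, ← mul_assoc, ih, mul_assoc, add_mul, h2', c, a1, c', mul_assoc]
      congr 1
      noncomm_ring
  induction p using Polynomial.induction_on with
  | C a => simp [Algebra.commutes]
  | add p q hp hq => simp only [map_add, add_mul, hp, hq, add_comp, mul_add]
  | monomial n a ih =>
    rw [pow_succ, ← mul_assoc, map_mul, aeval_X, mul_assoc, key, ← mul_assoc, ih, mul_comp,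
      map_mul, mul_assoc]
    simp

lemma sl2_split {e f h : End ℚ M} (h1 : e * f - f * e = h) (h2 : h * e - e * h = 2 * e)
    (h3 : h * f - f * h = -(2 * f)) (he : IsNilpotent e) (hf : IsNilpotent f) :
    ∃ p : ℚ[X], p ≠ 0 ∧ p.Splits ∧ aeval h p = 0 := by
  obtain ⟨a, ha⟩ := he
  obtain ⟨b, hb⟩ := hf
  set P : ℚ[X] := ∏ i ∈ Finset.range b, (X - C (i : ℚ)) with hP
  have hP0 : P.Monic := monic_prod_of_monic _ _ fun i _ => monic_X_sub_C _
  have hPs : P.Splits := Splits.prod fun i _ => Splits.X_sub_C _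
  have hPk : ∀ v, e v = 0 → aeval h P v = 0 := by
    intro v hv
    have := sl2_ker h1 h2 h3 b v hv
    rw [hb] at this
    simp only [LinearMap.zero_apply, map_zero] at this
    exact (smul_eq_zero.mp this.symm).resolve_left (by exact_mod_cast b.factorial_ne_zero)
  have : ∀ j : ℕ, ∃ p : ℚ[X], p.Monic ∧ p.Splits ∧ ∀ v, (e ^ j) v = 0 → aeval h p v = 0 := by
    intro j
    induction j with
    | zero => exact ⟨1, monic_one, Splits.one, fun v hv => by simpa using hv⟩
    | succ j ih =>
      obtain ⟨p, hp, hps, hpk⟩ := ih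
      refine ⟨p * P.comp (X + C (2 * j : ℚ)), hp.mul (hP0.comp_X_add_C _),
        hps.mul (hPs.comp_X_add_C _), fun v hv => ?_⟩
      rw [map_mul, End.mul_apply]
      apply hpk
      rw [← End.mul_apply, ← sl2_shift h2, End.mul_apply]
      apply hPk
      rw [← End.mul_apply, ← pow_succ', hv]
  obtain ⟨p, hp, hps, hpk⟩ := this a
  refine ⟨p, hp.ne_zero, hps, LinearMap.ext fun v => hpk v ?_⟩
  rw [ha]; rfl

lemma iSup_maxGen_of_splits {h : End ℚ M} {p : ℚ[X]} (hp0 : p ≠ 0) (hps : p.Splits)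
    (hp : aeval h p = 0) : ⨆ μ, h.maxGenEigenspace μ = ⊤ := by
  classical
  have key : ∀ s : Finset ℚ, ∀ k : ℚ → ℕ,
      LinearMap.ker (aeval h (∏ μ ∈ s, (X - C μ) ^ k μ)) ≤ ⨆ μ, h.maxGenEigenspace μ := by
    intro s k
    induction s using Finset.induction_on with
    | empty => 
      intro x hx
      have : x = 0 := by simpa using hx
      rw [this]; exact zero_mem _
    | insert a s ha ih =>
      rw [Finset.prod_insert ha, ← Polynomial.sup_ker_aeval_eq_ker_aeval_mul_of_coprime]
      · refine sup_le ?_ ih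
        refine le_trans ?_ (le_iSup _ a)
        intro x hx
        rw [End.mem_maxGenEigenspace]
        refine ⟨k a, ?_⟩
        simpa [LinearMap.mem_ker, Algebra.algebraMap_eq_smul_one] using hx
      · refine IsCoprime.prod_right fun i hi => IsCoprime.pow ?_
        apply Polynomial.pairwise_coprime_X_sub_C Function.injective_id
        rintro rfl
        exact ha hi
  have e := hps.eq_prod_roots
  rw [Finset.prod_multiset_map_count] at e
  rw [eq_top_iff]
  refine le_trans ?_ (key p.roots.toFinset fun μ => p.roots.count μ)
  intro x _
  rw [LinearMap.mem_ker]
  have h2 := congrArg (aeval h) e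
  rw [hp, map_mul, aeval_C] at h2
  have h3 := congrArg (fun g : End ℚ M => g x) h2
  simp only [LinearMap.zero_apply, End.mul_apply, Module.algebraMap_end_apply] at h3
  exact (smul_eq_zero.mp h3.symm).resolve_left (by simpa using hp0)

lemma trace_sq_aux [FiniteDimensional ℚ M] {h : End ℚ M} (hh : ⨆ μ, h.maxGenEigenspace μ = ⊤) :
    0 ≤ LinearMap.trace ℚ M (h * h) ∧ (LinearMap.trace ℚ M (h * h) = 0 → IsNilpotent h) := by
  classical
  have hds := DirectSum.isInternal_submodule_of_iSupIndep_of_iSup_eq_top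
      h.independent_maxGenEigenspace hh
  have h_fin : {μ | h.maxGenEigenspace μ ≠ ⊥}.Finite :=
      WellFoundedGT.finite_ne_bot_of_iSupIndep h.independent_maxGenEigenspace
  have hm1 : ∀ μ, Set.MapsTo h (h.maxGenEigenspace μ) (h.maxGenEigenspace μ) :=
    fun μ => h.mapsTo_maxGenEigenspace_of_comm rfl μ
  have hm : ∀ μ, Set.MapsTo (h * h : End ℚ M) (h.maxGenEigenspace μ) (h.maxGenEigenspace μ) :=
    fun μ => (hm1 μ).comp (hm1 μ)
  have htr : ∀ μ, LinearMap.trace ℚ _ ((h * h : End ℚ M).restrict (hm μ)) =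
      μ * (μ * (finrank ℚ (h.maxGenEigenspace μ))) := by
    intro μ
    have hn := h.isNilpotent_restrict_maxGenEigenspace_sub_algebraMap μ
    have e1 : (h * h : End ℚ M).restrict (hm μ) = (h.restrict (hm1 μ)) ∘ₗ (h.restrict (hm1 μ)) := rfl
    have e2 := LinearMap.trace_comp_eq_mul_of_commute_of_isNilpotent μ
      (Commute.one_left (h.restrict (hm1 μ))) hn
    have e3 : (1 : End ℚ (h.maxGenEigenspace μ)) ∘ₗ (h.restrict (hm1 μ)) = h.restrict (hm1 μ) := rfl
    rw [e3, LinearMap.trace_one] at e2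
    rw [e1, LinearMap.trace_comp_eq_mul_of_commute_of_isNilpotent μ (Commute.refl _) hn, e2]
  have htr2 := LinearMap.trace_eq_sum_trace_restrict' hds h_fin hm
  simp only [htr] at htr2
  have hnn : ∀ μ : ℚ, 0 ≤ μ * (μ * (finrank ℚ (h.maxGenEigenspace μ) : ℚ)) := by
    intro μ
    rw [← mul_assoc]
    exact mul_nonneg (mul_self_nonneg _) (Nat.cast_nonneg _)
  refine ⟨htr2 ▸ Finset.sum_nonneg fun μ _ => hnn μ, fun h0 => ?_⟩
  rw [htr2, Finset.sum_eq_zero_iff_of_nonneg fun μ _ => hnn μ] at h0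
  have hbot : ∀ μ, μ ≠ 0 → h.maxGenEigenspace μ = ⊥ := by
    intro μ hμ
    by_contra hne
    have := h0 μ (by simpa using hne)
    simp only [mul_eq_zero, hμ, false_or, Nat.cast_eq_zero, Submodule.finrank_eq_zero] at this
    exact hne this
  have htop : h.maxGenEigenspace 0 = ⊤ := by
    rw [eq_top_iff, ← hh]
    refine iSup_le fun μ => ?_
    by_cases hμ : μ = 0
    · rw [hμ]
    · rw [hbot μ hμ]; exact bot_le
  refine ⟨finrank ℚ M, LinearMap.ext fun x => ?_⟩
  have hx : x ∈ h.maxGenEigenspace 0 := htop ▸ Submodule.mem_top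
  rw [h.maxGenEigenspace_eq_genEigenspace_finrank, End.mem_genEigenspace_nat] at hx
  simpa using hx

lemma sl2_trace [FiniteDimensional ℚ M] {e f h : End ℚ M} (h1 : e * f - f * e = h)
    (h2 : h * e - e * h = 2 * e)
    (h3 : h * f - f * h = -(2 * f)) (he : IsNilpotent e) (hf : IsNilpotent f) :
    0 ≤ LinearMap.trace ℚ M (h * h) ∧ (LinearMap.trace ℚ M (h * h) = 0 → e = 0) := by
  obtain ⟨p, hp0, hps, hp⟩ := sl2_split h1 h2 h3 he hf
  obtain ⟨t1, t2⟩ := trace_sq_aux (iSup_maxGen_of_splits hp0 hps hp)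
  refine ⟨t1, fun h0 => ?_⟩
  have hn := t2 h0
  obtain ⟨k, hk⟩ := hn
  have e1 := sl2_shift h2 1 (X ^ k)
  simp only [map_pow, aeval_X, hk, zero_mul, pow_one, X_pow_comp, map_add, aeval_C] at e1
  have hu : IsUnit ((h + algebraMap ℚ (End ℚ M) (2 * ((1 : ℕ) : ℚ))) ^ k) := by
    refine IsUnit.pow k ?_
    refine IsNilpotent.isUnit_add_right_of_commute ⟨k, hk⟩ ?_ ?_
    · exact (IsUnit.mk0 (2 * ((1 : ℕ) : ℚ)) (by norm_num)).map (algebraMap ℚ (End ℚ M))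
    · exact (Algebra.commutes _ _).symm
  exact (hu.mul_left_eq_zero).mp e1.symm
end SL2

section SLN
attribute [local instance] LieRing.ofAssociativeRing
variable {n : ℕ} {A : Type*} [Ring A]

/-- The Steinberg relations (Lie algebra version). -/
structure SteinRel (X : Fin n → Fin n → A) : Prop where
  s1 : ∀ i j k, i ≠ j → j ≠ k → i ≠ k → ⁅X i j, X j k⁆ = X i k
  s2 : ∀ i j k l, i ≠ j → k ≠ l → j ≠ k → i ≠ l → ⁅X i j, X k l⁆ = 0

/-- The coroot. -/
def HH (X : Fin n → Fin n → A) (i j : Fin n) : A := ⁅X i j, X j i⁆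

/-- The diagonal elements. -/
noncomputable def DD [Algebra ℚ A] (X : Fin n → Fin n → A) (i : Fin n) : A :=
  (n : ℚ)⁻¹ • ∑ j, HH X i j

/-- The full matrix of elements. -/
noncomputable def EE [Algebra ℚ A] (X : Fin n → Fin n → A) (i j : Fin n) : A :=
  if i = j then DD X i else X i j

/-- The Casimir element. -/
noncomputable def casimir [Algebra ℚ A] (X : Fin n → Fin n → A) : A :=
  ∑ i, ∑ j, EE X i j * EE X j i

/-- Kronecker delta. -/
def dl (i j : Fin n) : ℚ := if i = j then 1 else 0

lemma exists_third (hn : 3 ≤ n) (i j : Fin n) : ∃ t : Fin n, t ≠ i ∧ t ≠ j := by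
  by_contra! h
  have : (Finset.univ : Finset (Fin n)) ⊆ {i, j} := by
    intro t _
    by_cases ht : t = i
    · simp [ht]
    · simp [h t ht]
  have h1 := Finset.card_le_card this
  have h2 : ({i, j} : Finset (Fin n)).card ≤ 2 := Finset.card_le_two
  simp at h1
  omega

variable {X : Fin n → Fin n → A}

lemma HH_self (i : Fin n) : HH X i i = 0 := lie_self _
lemma HH_anti (i j : Fin n) : HH X i j = - HH X j i := (lie_skew _ _).symm

lemma SteinRel.s1' (hX : SteinRel X) (i j k : Fin n) (h1 : i ≠ j) (h2 : j ≠ k) (h3 : i ≠ k) :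
    ⁅X j k, X i j⁆ = - X i k := by
  rw [← lie_skew, hX.s1 i j k h1 h2 h3]

lemma HH_add (hX : SteinRel X) (i j k : Fin n) (h1 : i ≠ j) (h2 : j ≠ k) (h3 : i ≠ k) :
    HH X i j = HH X i k + HH X k j := by
  have e : HH X i j = ⁅⁅X i k, X k j⁆, X j i⁆ := by rw [hX.s1 i k j h3 h2.symm h1]; rfl
  rw [e, lie_lie, hX.s1 k j i h2.symm h1.symm h3.symm, hX.s1' j i k h1.symm h3 h2, lie_neg,
    sub_neg_eq_add]
  rfl

variable [Algebra ℚ A]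

lemma HH_wt (hn : 3 ≤ n) (hX : SteinRel X) (i j k l : Fin n) (hkl : k ≠ l) :
    ⁅HH X i j, X k l⁆ = (dl i k - dl i l - dl j k + dl j l) • X k l := by
  have w1 : ∀ i j l, i ≠ j → l ≠ i → l ≠ j → ⁅HH X i j, X i l⁆ = X i l := by
    intro i j l h1 h2 h3
    rw [HH, lie_lie, hX.s1 j i l h1.symm h2.symm h3.symm, hX.s1 i j l h1 h3.symm h2.symm,
      hX.s2 i j i l h1 h2.symm h1.symm h2.symm, lie_zero, sub_zero]
  have w2 : ∀ i j k, i ≠ j → k ≠ i → k ≠ j → ⁅HH X i j, X k j⁆ = X k j := by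
    intro i j k h1 h2 h3
    rw [HH, lie_lie, hX.s1' k j i h3 h1.symm h2, lie_neg, hX.s1' k i j h2 h1 h3, 
      hX.s2 i j k j h1 h3 h3.symm h1, lie_zero, sub_zero, neg_neg]
  have w3 : ∀ i j, i ≠ j → ⁅HH X i j, X i j⁆ = (2 : ℚ) • X i j := by
    intro i j h1
    obtain ⟨t, h2, h3⟩ := exists_third hn i j
    rw [← hX.s1 i t j h2.symm h3 h1, leibniz_lie, w1 i j t h1 h2 h3, w2 i j t h1 h2 h3, two_smul]
  by_cases hij : i = j
  · subst hij
    rw [HH_self, zero_lie]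
    have : dl i k - dl i l - dl i k + dl i l = 0 := by ring
    rw [this, zero_smul]
  by_cases hik : i = k
  · subst hik
    by_cases hjl : j = l
    · subst hjl
      rw [w3 i j hij]
      congr 1
      simp [dl, hij, Ne.symm hij]; norm_num
    · rw [w1 i j l hij hkl.symm (Ne.symm hjl)]
      simp [dl, hij, Ne.symm hij, hkl, hjl]
  by_cases hjl : j = l
  · subst hjl
    rw [w2 i j k hij (Ne.symm hik) hkl]
    simp [dl, hij, hkl.symm, hik]
  by_cases hjk : j = k
  · subst hjk
    rw [HH_anti, neg_lie]
    by_cases hil : i = l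
    · subst hil
      rw [w3 j i hkl, ← neg_smul]
      congr 1
      simp [dl, hik, Ne.symm hij]; norm_num
    · rw [w1 j i l (Ne.symm hij) (Ne.symm hjl) (Ne.symm hil)]
      simp [dl, hik, hil, hjl]
  by_cases hil : i = l
  · subst hil
    rw [HH_anti, neg_lie, w2 j i k (Ne.symm hij) (Ne.symm hjk) hkl]
    simp [dl, hik, hjk, hjl]
  · rw [HH, lie_lie, hX.s2 j i k l (Ne.symm hij) hkl hik hjl,
      hX.s2 i j k l hij hkl hjk hil]
    simp [dl, hik, hjk, hjl, hil]

lemma DD_wt (hn : 3 ≤ n) (hX : SteinRel X) (i k l : Fin n) (hkl : k ≠ l) :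
    ⁅DD X i, X k l⁆ = (dl i k - dl i l) • X k l := by
  rw [DD, smul_lie, sum_lie]
  simp only [HH_wt hn hX _ _ _ _ hkl]
  rw [← Finset.sum_smul, smul_smul]
  congr 1
  simp only [Finset.sum_add_distrib, Finset.sum_sub_distrib, Finset.sum_const, Finset.card_univ,
    Fintype.card_fin, nsmul_eq_mul]
  have : ∀ k : Fin n, ∑ j, dl j k = 1 := by intro k; simp [dl]
  rw [this, this]
  have : (n : ℚ) ≠ 0 := by positivity
  field_simp
  ring

lemma DD_sub (hn : 3 ≤ n) (hX : SteinRel X) (k l : Fin n) :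
    DD X k - DD X l = HH X k l := by
  rw [DD, DD, ← smul_sub, ← Finset.sum_sub_distrib]
  have : ∀ j, HH X k j - HH X l j = HH X k l := by
    intro j
    by_cases hkl : k = l
    · subst hkl; rw [HH_self, sub_self]
    by_cases hjk : j = k
    · subst hjk; rw [HH_self, HH_anti l j]; abel
    by_cases hjl : j = l
    · subst hjl; rw [HH_self, sub_zero]
    rw [HH_add hX k l j hkl (Ne.symm hjl) (Ne.symm hjk), HH_anti l j]; abel
  simp only [this, Finset.sum_const, Finset.card_univ, Fintype.card_fin]
  rw [← Nat.cast_smul_eq_nsmul ℚ, smul_smul, inv_mul_cancel₀ (by positivity), one_smul]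

lemma EE_rel (hn : 3 ≤ n) (hX : SteinRel X) (k l i j : Fin n) (hkl : k ≠ l) :
    ⁅X k l, EE X i j⁆ = (if i = l then EE X k j else 0) - (if j = k then EE X i l else 0) := by
  by_cases hij : i = j
  · subst hij
    rw [EE, if_pos rfl, ← lie_skew, DD_wt hn hX _ _ _ hkl]
    by_cases hil : i = l
    · subst hil
      simp [dl, Ne.symm hkl, EE, hkl]
    · by_cases hik : i = k
      · subst hik; simp [dl, hil, EE]
      · simp [dl, hil, hik]
  · rw [EE, if_neg hij]
    by_cases hil : i = l
    · subst hil
      by_cases hjk : j = k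
      · subst hjk
        simp only [if_true, EE]
        rw [DD_sub hn hX]; rfl
      · rw [hX.s1 k i j hkl hij (Ne.symm hjk)]
        simp [EE, hjk, Ne.symm hjk]
    · by_cases hjk : j = k
      · subst hjk
        rw [hX.s1' i j l hij hkl hil]
        simp [EE, hil]
      · rw [hX.s2 k l i j hkl hij (Ne.symm hil) (Ne.symm hjk)]
        simp [hil, hjk]

lemma casimir_comm (hn : 3 ≤ n) (hX : SteinRel X) (k l : Fin n) (hkl : k ≠ l) :
    Commute (X k l) (casimir X) := by
  rw [commute_iff_lie_eq, casimir, lie_sum]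
  have hd : ∀ a b c : A, ⁅a, b * c⁆ = ⁅a, b⁆ * c + b * ⁅a, c⁆ := by
    intro a b c; simp only [Ring.lie_def]; noncomm_ring
  simp only [lie_sum, hd, EE_rel hn hX _ _ _ _ hkl, sub_mul, mul_sub, ite_mul, mul_ite, zero_mul,
    mul_zero, Finset.sum_add_distrib, Finset.sum_sub_distrib, Finset.sum_ite_eq', Finset.mem_univ,
    if_true]
  have e1 : ∀ g : Fin n → A, (∀ l : Fin n, ∑ x, ∑ y : Fin n, (if x = l then g y else 0) = ∑ y, g y) := by
    intro g l
    rw [Finset.sum_comm]; simp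
  have e2 : ∀ (g : Fin n → Fin n → A), (∀ l : Fin n, ∑ x, ∑ y : Fin n, (if x = l then g x y else 0) = ∑ y, g l y) := by
    intro g l
    rw [Finset.sum_comm]; simp
  rw [e2 (fun x y => EE X k y * EE X y x), e2 (fun x y => EE X x y * EE X y l)]
  abel
end SLN

section SLNtrace
attribute [local instance] LieRing.ofAssociativeRing
open Module
variable {n : ℕ} {M : Type*} [AddCommGroup M] [Module ℚ M] [FiniteDimensional ℚ M]

lemma sln_trivial (hn : 3 ≤ n) {X : Fin n → Fin n → End ℚ M} (hX : SteinRel X)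
    (hnil : ∀ i j, i ≠ j → IsNilpotent (X i j)) (hC : IsNilpotent (casimir X)) (i j : Fin n)
    (hij : i ≠ j) : X i j = 0 := by
  set tr := LinearMap.trace ℚ M with htr
  have hcyc : ∀ a b : End ℚ M, tr (a * b) = tr (b * a) := LinearMap.trace_mul_comm ℚ
  have two : ∀ a : End ℚ M, (2 : ℚ) • a = 2 * a := fun a => by rw [two_smul, two_mul]
  have w1 : ∀ i j, i ≠ j → HH X i j * X i j - X i j * HH X i j = 2 * X i j := by
    intro i j h
    have := HH_wt hn hX i j i j h
    rw [Ring.lie_def] at this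
    rw [this, ← two]
    congr 1
    simp [dl, h, Ne.symm h]; norm_num
  have w2 : ∀ i j, i ≠ j → HH X i j * X j i - X j i * HH X i j = -(2 * X j i) := by
    intro i j h
    have := HH_wt hn hX i j j i h.symm
    rw [Ring.lie_def] at this
    rw [this, ← two, ← neg_smul]
    congr 1
    simp [dl, h, Ne.symm h]; norm_num
  have hsl : ∀ i j, i ≠ j → 0 ≤ tr (HH X i j * HH X i j) ∧ (tr (HH X i j * HH X i j) = 0 → X i j = 0) :=
    fun i j h => sl2_trace rfl (w1 i j h) (w2 i j h) (hnil i j h) (hnil j i h.symm)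
  have t1 : ∀ i j, i ≠ j → tr (X i j * X j i) = (1 / 2) * tr (HH X i j * HH X i j) := by
    intro i j h
    have e : HH X i j * HH X i j = X i j * X j i * HH X i j - X j i * X i j * HH X i j := by
      conv_lhs => enter [1]; rw [HH, Ring.lie_def]
      rw [sub_mul]
    have e2 : tr (X j i * X i j * HH X i j) = tr (X i j * (HH X i j * X j i)) := by
      rw [mul_assoc, hcyc, mul_assoc]
    have e3 : X i j * X j i * HH X i j - X i j * (HH X i j * X j i) = (2 : ℚ) • (X i j * X j i) := by
      have : X j i * HH X i j - HH X i j * X j i = (2 : ℚ) • X j i := by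
        rw [two, ← neg_sub, w2 i j h, neg_neg]
      rw [mul_assoc, ← mul_sub, this, mul_smul_comm]
    rw [e, map_sub, e2, ← map_sub, e3, map_smul, smul_eq_mul]
    ring
  have hD0 : ∑ i, DD X i = 0 := by
    simp only [DD]
    rw [← Finset.smul_sum]
    have : ∑ i, ∑ j, HH X i j = - ∑ i, ∑ j, HH X i j := by
      conv_lhs => rw [Finset.sum_comm]
      rw [← Finset.sum_neg_distrib]
      refine Finset.sum_congr rfl fun i _ => ?_
      rw [← Finset.sum_neg_distrib]
      exact Finset.sum_congr rfl fun j _ => HH_anti j i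
    have h2 : (2 : ℚ) • ∑ i, ∑ j, HH X i j = 0 := by
      rw [two_smul]
      nth_rewrite 1 [this]
      exact neg_add_cancel _
    rw [(smul_eq_zero.mp h2).resolve_left (by norm_num), smul_zero]
  have t2 : ∑ i, ∑ j, tr (HH X i j * HH X i j) = 2 * n * ∑ i, tr (DD X i * DD X i) := by
    have e : ∀ i j, tr (HH X i j * HH X i j) = tr (DD X i * DD X i) + tr (DD X j * DD X j)
        - 2 * tr (DD X i * DD X j) := by
      intro i j
      rw [← DD_sub hn hX i j, sub_mul, mul_sub, mul_sub, map_sub, map_sub, map_sub,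
        hcyc (DD X j) (DD X i)]
      ring
    have e' : ∑ i, ∑ j, tr (DD X i * DD X j) = 0 := by
      simp only [← map_sum, ← Finset.mul_sum, hD0, mul_zero, map_zero, Finset.sum_const_zero]
    simp only [e, Finset.sum_sub_distrib, Finset.sum_add_distrib, ← Finset.mul_sum, e',
      Finset.sum_const, Finset.card_univ, Fintype.card_fin, nsmul_eq_mul]
    ring
  have t3 : tr (casimir X) = ∑ i, tr (DD X i * DD X i) +
      (1 / 2) * ∑ i, ∑ j, tr (HH X i j * HH X i j) := by
    have e : ∀ i j, tr (EE X i j * EE X j i) = (if i = j then tr (DD X i * DD X i) else 0)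
        + (1 / 2) * tr (HH X i j * HH X i j) := by
      intro i j
      by_cases h : i = j
      · subst h; simp [EE, HH_self]
      · simp only [EE, if_neg h, if_neg (Ne.symm h), t1 i j h]; ring
    simp only [casimir, map_sum, e, Finset.sum_add_distrib, ← Finset.mul_sum, Finset.sum_ite_eq,
      Finset.mem_univ, if_true]
  have t4 : tr (casimir X) = 0 := by
    have := LinearMap.isNilpotent_trace_of_isNilpotent hC
    exact this.eq_zero
  have hnn : ∀ i j, 0 ≤ tr (HH X i j * HH X i j) := by
    intro i j
    by_cases h : i = j
    · subst h; simp [HH_self]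
    · exact (hsl i j h).1
  have t5 : ∑ i, ∑ j, tr (HH X i j * HH X i j) = 0 := by
    have hn0 : (0 : ℚ) < n := by positivity
    have hge : 0 ≤ ∑ i, ∑ j, tr (HH X i j * HH X i j) :=
      Finset.sum_nonneg fun i _ => Finset.sum_nonneg fun j _ => hnn i j
    have hge2 : 0 ≤ ∑ i, tr (DD X i * DD X i) := by
      rw [t2] at hge
      exact nonneg_of_mul_nonneg_right hge (by positivity)
    linarith
  rw [Finset.sum_eq_zero_iff_of_nonneg fun i _ => Finset.sum_nonneg fun j _ => hnn i j] at t5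
  have t6 := t5 i (Finset.mem_univ _)
  rw [Finset.sum_eq_zero_iff_of_nonneg fun j _ => hnn i j] at t6
  exact (hsl i j hij).2 (t6 j (Finset.mem_univ _))
end SLNtrace

section QU
open Module

lemma eig_root {K M : Type*} [Field K] [AddCommGroup M] [Module K M] [FiniteDimensional K M]
    {A B T : End K M} (hA : IsUnit A) (hB : IsUnit B) (hTA : Commute T A) (hTB : Commute T B)
    (h : A * B = T * B * A) {μ : K} (hμ : T.HasEigenvalue μ) :
    μ ^ (finrank K M).factorial = 1 := by
  set E := T.eigenspace μ with hE
  have st : ∀ {C : End K M}, Commute T C → ∀ x ∈ E, C x ∈ E := by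
    intro C hC x hx
    rw [hE, End.mem_eigenspace_iff] at hx ⊢
    rw [← End.mul_apply, hC.eq, End.mul_apply, hx, map_smul]
  have hd : ∀ {C : End K M}, IsUnit C → ∀ hC : Commute T C, LinearMap.det (C.restrict (st hC)) ≠ 0 := by
    intro C hu hC
    have inj : Function.Injective (C.restrict (st hC)) := by
      intro x y hxy
      have h2 := congrArg Subtype.val hxy
      simp only [LinearMap.coe_restrict_apply] at h2
      exact Subtype.ext (((End.isUnit_iff C).mp hu).1 h2)
    have bij : Function.Bijective (C.restrict (st hC)) := ⟨inj, LinearMap.injective_iff_surjective.mp inj⟩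
    exact (LinearMap.isUnit_det _ ((End.isUnit_iff _).mpr bij)).ne_zero
  have e : (A.restrict (st hTA)) * (B.restrict (st hTB)) =
      μ • ((B.restrict (st hTB)) * (A.restrict (st hTA))) := by
    ext x
    have h1 := congrArg (fun g : End K M => g x) h
    simp only [End.mul_apply] at h1
    have h2 := st hTB _ (st hTA _ x.2)
    rw [End.mem_eigenspace_iff.mp h2] at h1
    simpa using h1
  have e2 := congrArg LinearMap.det e
  rw [map_mul, LinearMap.det_smul, map_mul] at e2
  have h1 : μ ^ finrank K E = 1 := by
    have n1 := hd hA hTA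
    have n2 := hd hB hTB
    have : (μ ^ finrank K E) * (LinearMap.det (B.restrict (st hTB)) * LinearMap.det (A.restrict (st hTA)))
       = 1 * (LinearMap.det (B.restrict (st hTB)) * LinearMap.det (A.restrict (st hTA))) := by
      rw [← e2]; ring
    exact mul_right_cancel₀ (mul_ne_zero n2 n1) this
  have hpos : 0 < finrank K E := by
    rw [Nat.pos_iff_ne_zero, Ne, Submodule.finrank_eq_zero]
    exact hμ
  obtain ⟨c, hc⟩ := Nat.dvd_factorial hpos (Submodule.finrank_le E)
  rw [hc, pow_mul, h1, one_pow]

lemma quasi_unip_closed {K M : Type*} [Field K] [IsAlgClosed K] [AddCommGroup M] [Module K M]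
    [FiniteDimensional K M]
    {A B T : End K M} (hA : IsUnit A) (hB : IsUnit B) (hTA : Commute T A) (hTB : Commute T B)
    (h : A * B = T * B * A) : IsNilpotent (T ^ (finrank K M).factorial - 1) := by
  set m := (finrank K M).factorial with hm
  have key : ∀ μ, T.maxGenEigenspace μ ≤ (T ^ m - 1).maxGenEigenspace 0 := by
    intro μ
    by_cases hμ : T.HasEigenvalue μ
    · have h1 := eig_root hA hB hTA hTB h hμ
      intro x hx
      rw [End.mem_maxGenEigenspace] at hx ⊢
      obtain ⟨k, hk⟩ := hx
      refine ⟨k, ?_⟩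
      have hc : Commute T (μ • (1 : End K M)) := (Commute.one_right T).smul_right μ
      have h2 := hc.mul_geom_sum₂ m
      have h3 : (μ • (1 : End K M)) ^ m = 1 := by rw [smul_pow, h1, one_pow, one_smul]
      rw [h3] at h2
      rw [zero_smul, sub_zero, ← h2]
      have hc2 : Commute (T - μ • (1 : End K M)) 
        (∑ i ∈ Finset.range m, T ^ i * (μ • (1 : End K M)) ^ (m - 1 - i)) := by
        refine Commute.sum_right _ _ _ fun i _ => ?_
        refine Commute.mul_right ?_ ?_
        · exact ((Commute.refl T).sub_left hc.symm).pow_right _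
        · exact (hc.sub_left (Commute.refl _)).pow_right _
      rw [hc2.mul_pow, (hc2.pow_pow k k).eq, End.mul_apply, hk, map_zero]
    · have : T.maxGenEigenspace μ = ⊥ := by
        by_contra hne
        exact hμ ((End.hasUnifEigenvalue_iff_hasUnifEigenvalue_one (k := ⊤) (by simp)).mp hne)
      rw [this]; exact bot_le
  have htop : (T ^ m - 1).maxGenEigenspace 0 = ⊤ := by
    rw [eq_top_iff, ← End.iSup_maxGenEigenspace_eq_top T]
    exact iSup_le key
  refine ⟨finrank K M, LinearMap.ext fun x => ?_⟩
  have hx : x ∈ (T ^ m - 1).maxGenEigenspace 0 := htop ▸ Submodule.mem_top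
  rw [End.maxGenEigenspace_eq_genEigenspace_finrank, End.mem_genEigenspace_nat] at hx
  simpa using hx

open TensorProduct in
lemma quasi_unip {M : Type*} [AddCommGroup M] [Module ℚ M]
    [FiniteDimensional ℚ M]
    {A B T : End ℚ M} (hA : IsUnit A) (hB : IsUnit B) (hTA : Commute T A) (hTB : Commute T B)
    (h : A * B = T * B * A) : IsNilpotent (T ^ (finrank ℚ M).factorial - 1) := by
  let K := AlgebraicClosure ℚ
  let φ := End.baseChangeHom ℚ K M
  have hφ : Function.Injective φ := LinearMap.baseChangeHom_injective ℚ M K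
  have := quasi_unip_closed (hA.map φ) (hB.map φ) (hTA.map φ) (hTB.map φ)
    (by rw [← map_mul, h, map_mul, map_mul])
  rw [Module.finrank_baseChange] at this
  have e : φ (T ^ (finrank ℚ M).factorial - 1) = (φ T) ^ (finrank ℚ M).factorial - 1 := by
    rw [map_sub φ, map_pow φ, map_one φ]
  rw [← e] at this
  obtain ⟨k, hk⟩ := this
  refine ⟨k, hφ ?_⟩
  rw [map_pow, hk, map_zero]
end QU

set_option linter.unusedSimpArgs false
section Elem
open Matrix
variable {n : ℕ}

/-- Block matrix with a `2 × 2` block in rows and columns `i`, `j`. -/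
def blk (i j : Fin n) (A : Matrix (Fin 2) (Fin 2) ℤ) : Matrix (Fin n) (Fin n) ℤ :=
  1 + (A 0 0 - 1) • single i i 1 + A 0 1 • single i j 1 + A 1 0 • single j i 1
    + (A 1 1 - 1) • single j j 1

lemma blk_one (i j : Fin n) : blk i j 1 = 1 := by
  simp [blk]

lemma blk_mul {i j : Fin n} (h : i ≠ j) (A B : Matrix (Fin 2) (Fin 2) ℤ) :
    blk i j (A * B) = blk i j A * blk i j B := by
  simp only [blk, mul_apply, Fin.sum_univ_two, add_mul, mul_add, one_mul, mul_one, smul_mul_assoc,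
    mul_smul_comm, single_mul_single_same, single_mul_single_of_ne _ _ _ _ h,
    single_mul_single_of_ne _ _ _ _ h.symm, smul_zero]
  module

/-- The block embedding of `SL₂(ℤ)`. -/
def bet {i j : Fin n} (h : i ≠ j) : SpecialLinearGroup (Fin 2) ℤ →* GL (Fin n) ℤ :=
  MonoidHom.toHomUnits
    { toFun := fun A => blk i j A.1
      map_one' := blk_one i j
      map_mul' := fun A B => blk_mul h A.1 B.1 }

lemma bet_val {i j : Fin n} (h : i ≠ j) (A : SpecialLinearGroup (Fin 2) ℤ) :
    (bet h A).1 = blk i j A.1 := rfl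

/-- Elementary matrices. -/
def el (i j : Fin n) (c : ℤ) : GL (Fin n) ℤ :=
  if h : i ≠ j then 
    ⟨1 + c • single i j 1, 1 - c • single i j 1, by
      simp [mul_sub, add_mul, single_mul_single_of_ne _ _ _ _ h.symm], by
      simp [mul_add, sub_mul, single_mul_single_of_ne _ _ _ _ h.symm]⟩ 
  else 1

lemma el_val {i j : Fin n} (h : i ≠ j) (c : ℤ) : (el i j c).1 = 1 + c • single i j 1 := by
  rw [el, dif_pos h]

lemma el_add {i j : Fin n} (h : i ≠ j) (a b : ℤ) : el i j (a + b) = el i j a * el i j b := by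
  ext1
  rw [Units.val_mul, el_val h, el_val h, el_val h]
  simp only [add_mul, mul_add, one_mul, mul_one, smul_mul_assoc, mul_smul_comm,
    single_mul_single_of_ne _ _ _ _ h.symm, smul_zero]
  module

lemma el_zero {i j : Fin n} (h : i ≠ j) : el i j 0 = 1 := by
  ext1; rw [el_val h]; simp

lemma el_pow {i j : Fin n} (h : i ≠ j) (a : ℤ) (k : ℕ) : el i j a ^ k = el i j (k * a) := by
  induction k with
  | zero => simp [el_zero h]
  | succ k ih => rw [pow_succ, ih, ← el_add h]; congr 1; push_cast; ring

lemma el_neg {i j : Fin n} (h : i ≠ j) (a : ℤ) : el i j (-a) = (el i j a)⁻¹ := by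
  rw [eq_inv_iff_mul_eq_one, ← el_add h, neg_add_cancel, el_zero h]

lemma el_zpow {i j : Fin n} (h : i ≠ j) (a k : ℤ) : el i j a ^ k = el i j (k * a) := by
  cases k with
  | ofNat k => simpa using el_pow h a k
  | negSucc k =>
    rw [zpow_negSucc, el_pow h, ← el_neg h]; congr 1; simp [Int.negSucc_eq]; ring

lemma el_comm1 {i j k : Fin n} (h1 : i ≠ j) (h2 : j ≠ k) (h3 : i ≠ k) (a b : ℤ) :
    el i j a * el j k b = el i k (a * b) * el j k b * el i j a := by
  ext1
  simp only [Units.val_mul, el_val h1, el_val h2, el_val h3]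
  simp only [add_mul, mul_add, one_mul, mul_one, smul_mul_assoc, mul_smul_comm,
    single_mul_single_same,
    single_mul_single_of_ne _ _ _ _ h2.symm, single_mul_single_of_ne _ _ _ _ h3.symm,
    single_mul_single_of_ne _ _ _ _ h1.symm, smul_zero, zero_mul]
  module

lemma el_comm2 {i j k l : Fin n} (h1 : i ≠ j) (h2 : k ≠ l) (h3 : j ≠ k) (h4 : i ≠ l) (a b : ℤ) :
    Commute (el i j a) (el k l b) := by
  ext1
  simp only [Units.val_mul, el_val h1, el_val h2]
  simp only [add_mul, mul_add, one_mul, mul_one, smul_mul_assoc, mul_smul_comm,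
    single_mul_single_of_ne _ _ _ _ h3, single_mul_single_of_ne _ _ _ _ h4.symm, smul_zero]
  module

lemma bet_el1 {i j k : Fin n} (h1 : i ≠ j) (h2 : j ≠ k) (h3 : i ≠ k)
    (A : SpecialLinearGroup (Fin 2) ℤ) (x : ℤ) :
    bet h1 A * el i k x = el i k (A.1 0 0 * x) * el j k (A.1 1 0 * x) * bet h1 A := by
  ext1
  simp only [Units.val_mul, el_val h2, el_val h3, bet_val, blk]
  simp only [add_mul, mul_add, one_mul, mul_one, smul_mul_assoc, mul_smul_comm,
    single_mul_single_same,
    single_mul_single_of_ne _ _ _ _ h2.symm, single_mul_single_of_ne _ _ _ _ h3.symm,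
    single_mul_single_of_ne _ _ _ _ h1.symm, single_mul_single_of_ne _ _ _ _ h1, smul_zero, zero_mul]
  module

lemma bet_el2 {i j k : Fin n} (h1 : i ≠ j) (h2 : j ≠ k) (h3 : i ≠ k)
    (A : SpecialLinearGroup (Fin 2) ℤ) (x : ℤ) :
    bet h1 A * el j k x = el i k (A.1 0 1 * x) * el j k (A.1 1 1 * x) * bet h1 A := by
  ext1
  simp only [Units.val_mul, el_val h2, el_val h3, bet_val, blk]
  simp only [add_mul, mul_add, one_mul, mul_one, smul_mul_assoc, mul_smul_comm,
    single_mul_single_same,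
    single_mul_single_of_ne _ _ _ _ h2.symm, single_mul_single_of_ne _ _ _ _ h3.symm,
    single_mul_single_of_ne _ _ _ _ h1.symm, single_mul_single_of_ne _ _ _ _ h1, smul_zero, zero_mul]
  module

lemma bet_el3 {i j k : Fin n} (h1 : i ≠ j) (h2 : j ≠ k) (h3 : i ≠ k)
    (A : SpecialLinearGroup (Fin 2) ℤ) (x : ℤ) :
    el k i x * bet h1 A = bet h1 A * (el k i (A.1 0 0 * x) * el k j (A.1 0 1 * x)) := by
  ext1
  simp only [Units.val_mul, el_val h2.symm, el_val h3.symm, bet_val, blk]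
  simp only [add_mul, mul_add, one_mul, mul_one, smul_mul_assoc, mul_smul_comm,
    single_mul_single_same,
    single_mul_single_of_ne _ _ _ _ h2, single_mul_single_of_ne _ _ _ _ h3,
    single_mul_single_of_ne _ _ _ _ h1.symm, single_mul_single_of_ne _ _ _ _ h1, smul_zero, mul_zero]
  module

lemma bet_el4 {i j k : Fin n} (h1 : i ≠ j) (h2 : j ≠ k) (h3 : i ≠ k)
    (A : SpecialLinearGroup (Fin 2) ℤ) (x : ℤ) :
    el k j x * bet h1 A = bet h1 A * (el k i (A.1 1 0 * x) * el k j (A.1 1 1 * x)) := by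
  ext1
  simp only [Units.val_mul, el_val h2.symm, el_val h3.symm, bet_val, blk]
  simp only [add_mul, mul_add, one_mul, mul_one, smul_mul_assoc, mul_smul_comm,
    single_mul_single_same,
    single_mul_single_of_ne _ _ _ _ h2, single_mul_single_of_ne _ _ _ _ h3,
    single_mul_single_of_ne _ _ _ _ h1.symm, single_mul_single_of_ne _ _ _ _ h1, smul_zero, mul_zero]
  module

lemma bet_row1 {i j : Fin n} (h : i ≠ j) (A : SpecialLinearGroup (Fin 2) ℤ) (g : GL (Fin n) ℤ)
    (c : Fin n) : (bet h A * g).1 i c = A.1 0 0 * g.1 i c + A.1 0 1 * g.1 j c := by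
  simp only [Units.val_mul, bet_val, blk, add_mul, one_mul, smul_mul_assoc, Matrix.add_apply, Matrix.smul_apply,
    single_mul_apply_same, single_mul_apply_of_ne _ _ _ _ _ h, smul_eq_mul]
  ring

lemma bet_row2 {i j : Fin n} (h : i ≠ j) (A : SpecialLinearGroup (Fin 2) ℤ) (g : GL (Fin n) ℤ)
    (c : Fin n) : (bet h A * g).1 j c = A.1 1 0 * g.1 i c + A.1 1 1 * g.1 j c := by
  simp only [Units.val_mul, bet_val, blk, add_mul, one_mul, smul_mul_assoc, Matrix.add_apply, Matrix.smul_apply,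
    single_mul_apply_same, single_mul_apply_of_ne _ _ _ _ _ h.symm, smul_eq_mul]
  ring

lemma bet_row3 {i j : Fin n} (h : i ≠ j) (A : SpecialLinearGroup (Fin 2) ℤ) (g : GL (Fin n) ℤ)
    (r c : Fin n) (h1 : r ≠ i) (h2 : r ≠ j) : (bet h A * g).1 r c = g.1 r c := by
  simp only [Units.val_mul, bet_val, blk, add_mul, one_mul, smul_mul_assoc, Matrix.add_apply, Matrix.smul_apply,
    single_mul_apply_of_ne _ _ _ _ _ h1, single_mul_apply_of_ne _ _ _ _ _ h2, smul_eq_mul]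
  ring

lemma exists_sl2_kill (a b : ℤ) : ∃ A : SpecialLinearGroup (Fin 2) ℤ,
    A.1 1 0 * a + A.1 1 1 * b = 0 := by
  by_cases h : Int.gcd a b = 0
  · rw [Int.gcd_eq_zero_iff] at h
    exact ⟨1, by simp [h.1, h.2]⟩
  · have hg : (Int.gcd a b : ℤ) ≠ 0 := by exact_mod_cast h
    obtain ⟨a', ha⟩ := Int.gcd_dvd_left a b
    obtain ⟨b', hb⟩ := Int.gcd_dvd_right a b
    have hbz := Int.gcd_eq_gcd_ab a b
    set d : ℤ := (Int.gcd a b : ℤ)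
    refine ⟨⟨!![Int.gcdA a b, Int.gcdB a b; -b', a'], ?_⟩, ?_⟩
    · rw [det_fin_two_of]
      apply mul_left_cancel₀ hg
      calc d * (Int.gcdA a b * a' - Int.gcdB a b * -b') 
         = (d * a') * Int.gcdA a b + (d * b') * Int.gcdB a b := by ring
        _ = d * 1 := by rw [← ha, ← hb, ← hbz, mul_one]
    · simp only [of_apply, cons_val', cons_val_zero, cons_val_one, cons_val_fin_one]
      calc -b' * a + a' * b = -b' * (d * a') + a' * (d * b') := by rw [← ha, ← hb]
        _ = 0 := by ring

/-- Upper shear in `SL₂(ℤ)`. -/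
def shear (x : ℤ) : SpecialLinearGroup (Fin 2) ℤ := ⟨!![1, x; 0, 1], by simp⟩

lemma bet_shear {i j : Fin n} (h : i ≠ j) (x : ℤ) : bet h (shear x) = el i j x := by
  ext1
  rw [bet_val, el_val h]
  simp [blk, shear]

theorem elimination (R : (GL (Fin n) ℤ → Prop) → Prop)
    (hdiag : R (fun g => ∀ r c, r ≠ c → g.1 r c = 0))
    (hmono : ∀ P Q : GL (Fin n) ℤ → Prop, (∀ g, P g → Q g) → R Q → R P)
    (hstep : ∀ (P Q : GL (Fin n) ℤ → Prop) (i j : Fin n) (h : i ≠ j), R Q →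
      (∀ g, P g → ∃ A, Q (bet h A * g)) → R P) : R (fun _ => True) := by
  -- stage 2
  let P2 : ℕ → ℕ → GL (Fin n) ℤ → Prop := fun k s g =>
    (∀ r c : Fin n, c < r → g.1 r c = 0) ∧
    ∀ r c : Fin n, r < c → (c.1 < k ∨ (c.1 = k ∧ r.1 < s)) → g.1 r c = 0
  have s2 : ∀ k s, s < k → k < n → R (P2 k (s + 1)) → R (P2 k s) := by
    intro k s hsk hkn hR
    have hne : (⟨s, by omega⟩ : Fin n) ≠ ⟨k, hkn⟩ := by simp; omega
    refine hstep _ _ _ _ hne hR ?_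
    rintro g ⟨hg1, hg2⟩
    set rs : Fin n := ⟨s, by omega⟩ with hrs
    set ks : Fin n := ⟨k, hkn⟩ with hks
    have hlt : rs < ks := hsk
    have hunit : g.1 ks ks * g.1 ks ks = 1 := by
      have hd := det_of_isUpperTriangular (M := g.1) (fun r c h => hg1 r c h)
      have hu : IsUnit g.1.det := (Matrix.isUnit_iff_isUnit_det _).mp g.isUnit
      rw [hd, IsUnit.prod_univ_iff] at hu
      exact Int.isUnit_mul_self (hu ks)
    refine ⟨shear (-(g.1 rs ks * g.1 ks ks)), ?_, ?_⟩
    · intro r c hc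
      by_cases h1 : r = rs
      · subst h1
        rw [bet_row1, hg1 _ _ hc, hg1 _ _ (hc.trans hlt)]; simp
      by_cases h2 : r = ks
      · subst h2
        rw [bet_row2, hg1 _ _ hc]; simp [shear]
      rw [bet_row3 _ _ _ _ _ h1 h2, hg1 _ _ hc]
    · intro r c hc hcs
      by_cases h1 : r = rs
      · subst h1
        rw [bet_row1]
        by_cases h3 : c = ks
        · subst h3
          simp only [shear, of_apply, cons_val', cons_val_zero, cons_val_one, cons_val_fin_one]
          linear_combination (-g.1 rs ks) * hunit
        · have hck : c.1 < k := by
            rcases hcs with h | h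
            · exact h
            · exact absurd (Fin.ext h.1) h3
          rw [hg2 rs c hc (Or.inl hck), hg1 ks c hck]; simp
      by_cases h2 : r = ks
      · subst h2
        have := Fin.lt_def.mp hc
        simp only [hks] at this
        omega
      rw [bet_row3 _ _ _ _ _ h1 h2]
      refine hg2 r c hc ?_
      rcases hcs with h | ⟨h, h'⟩
      · exact Or.inl h
      · refine Or.inr ⟨h, ?_⟩
        have : r.1 ≠ s := fun h => h1 (Fin.ext h)
        omega
  have s2b : ∀ k, k < n → R (P2 (k + 1) 0) → R (P2 k 0) := by
    intro k hk hR
    have h0 : R (P2 k k) := by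
      refine hmono _ _ ?_ hR
      rintro g ⟨hg1, hg2⟩
      refine ⟨hg1, fun r c hrc h => hg2 r c hrc ?_⟩
      have := Fin.lt_def.mp hrc
      omega
    have : ∀ d, d ≤ k → R (P2 k (k - d)) := by
      intro d
      induction d with
      | zero => intro _; exact h0
      | succ d ih =>
        intro hd
        refine s2 k _ (by omega) hk ?_
        have e : k - (d + 1) + 1 = k - d := by omega
        rw [e]; exact ih (by omega)
    simpa using this k le_rfl
  have s2c : R (P2 0 0) := by
    have h0 : R (P2 n 0) := by
      refine hmono _ _ ?_ hdiag
      rintro g ⟨hg1, hg2⟩ r c hrc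
      rcases lt_or_gt_of_ne hrc with h | h
      · exact hg2 r c h (Or.inl c.2)
      · exact hg1 r c h
    have : ∀ d, d ≤ n → R (P2 (n - d) 0) := by
      intro d
      induction d with
      | zero => intro _; exact h0
      | succ d ih =>
        intro hd
        refine s2b _ (by omega) ?_
        have e : n - (d + 1) + 1 = n - d := by omega
        rw [e]; exact ih (by omega)
    simpa using this n le_rfl
  -- stage 1
  let P1 : ℕ → ℕ → GL (Fin n) ℤ → Prop := fun k s g =>
    ∀ r c : Fin n, c < r → (c.1 < k ∨ (c.1 = k ∧ r.1 < s)) → g.1 r c = 0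
  have s1 : ∀ k s, k < s → s < n → R (P1 k (s + 1)) → R (P1 k s) := by
    intro k s hks hsn hR
    have hne : (⟨k, by omega⟩ : Fin n) ≠ ⟨s, hsn⟩ := by simp; omega
    refine hstep _ _ _ _ hne hR ?_
    intro g hg
    set kk : Fin n := ⟨k, by omega⟩ with hkk
    set ss : Fin n := ⟨s, hsn⟩ with hss
    have hlt : kk < ss := hks
    obtain ⟨A, hA⟩ := exists_sl2_kill (g.1 kk kk) (g.1 ss kk)
    refine ⟨A, ?_⟩
    intro r c hc hcs
    by_cases h1 : r = kk
    · subst h1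
      have hck : c.1 < k := hc
      rw [bet_row1, hg _ _ hc (Or.inl hck), hg _ _ (hc.trans hlt) (Or.inl hck)]; simp
    by_cases h2 : r = ss
    · subst h2
      rw [bet_row2]
      by_cases h3 : c = kk
      · subst h3; exact hA
      · have hck : c.1 < k := by
          rcases hcs with h | h
          · exact h
          · exact absurd (Fin.ext h.1) h3
        rw [hg _ _ (show c < kk from hck) (Or.inl hck), hg _ _ hc (Or.inl hck)]; simp
    rw [bet_row3 _ _ _ _ _ h1 h2]
    refine hg r c hc ?_
    rcases hcs with h | ⟨h, h'⟩
    · exact Or.inl h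
    · refine Or.inr ⟨h, ?_⟩
      have : r.1 ≠ s := fun h => h2 (Fin.ext h)
      omega
  have s1b : ∀ k, k < n → R (P1 (k + 1) (k + 2)) → R (P1 k (k + 1)) := by
    intro k hk hR
    have h0 : R (P1 k n) := by
      refine hmono _ _ ?_ hR
      intro g hg r c hrc h
      refine hg r c hrc ?_
      have := Fin.lt_def.mp hrc
      have := r.2
      omega
    have : ∀ d, d + k + 1 ≤ n → R (P1 k (n - d)) := by
      intro d
      induction d with
      | zero => intro _; exact h0
      | succ d ih =>
        intro hd
        refine s1 k _ (by omega) (by omega) ?_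
        have e : n - (d + 1) + 1 = n - d := by omega
        rw [e]; exact ih (by omega)
    have h2 := this (n - (k + 1)) (by omega)
    have e : n - (n - (k + 1)) = k + 1 := by omega
    rwa [e] at h2
  have h0 : R (P1 n (n + 1)) := by
    refine hmono _ _ ?_ s2c
    intro g hg
    exact ⟨fun r c h => hg r c h (Or.inl c.2), fun r c _ h => by omega⟩
  have : ∀ d, d ≤ n → R (P1 (n - d) (n - d + 1)) := by
    intro d
    induction d with
    | zero => intro _; exact h0
    | succ d ih =>
      intro hd
      refine s1b _ (by omega) ?_
      have e : n - (d + 1) + 1 = n - d := by omega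
      rw [show n - (d + 1) + 2 = n - (d + 1) + 1 + 1 from rfl, e]; exact ih (by omega)
  have h1 := this n le_rfl
  refine hmono _ _ ?_ h1
  intro g _ r c hrc h
  have := Fin.lt_def.mp hrc
  omega
end Elem

set_option linter.unusedSimpArgs false
section Fin
open Matrix

lemma finite_of_SL2 {H : Type*} [Group H] (φ : SpecialLinearGroup (Fin 2) ℤ →* H)
    (hφ : Function.Surjective φ) (K : Subgroup (SpecialLinearGroup (Fin 2) ℤ)) [K.FiniteIndex]
    (hK : ∀ a ∈ K, φ a ∈ Subgroup.center H) (m : ℕ) (hm : 0 < m) (hT : φ ModularGroup.T ^ m = 1) :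
    Finite H := by
  have hci : (Subgroup.center H).FiniteIndex := by
    have h1 : K ≤ (Subgroup.center H).comap φ := hK
    have h2 : ((Subgroup.center H).comap φ).FiniteIndex := Subgroup.finiteIndex_of_le h1
    have h3 := h2.index_ne_zero
    rw [Subgroup.index_comap_of_surjective _ hφ] at h3
    exact ⟨h3⟩
  have hfin : Finite (commutatorSet H) := by
    have : Finite (H ⧸ Subgroup.center H) := Subgroup.finite_quotient_of_finiteIndex
    have hsub : commutatorSet H ⊆ Set.range (fun q : (H ⧸ Subgroup.center H) × (H ⧸ Subgroup.center H) =>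
        q.1.out * q.2.out * q.1.out⁻¹ * q.2.out⁻¹) := by
      rintro _ ⟨a, b, rfl⟩
      refine ⟨(QuotientGroup.mk a, QuotientGroup.mk b), ?_⟩
      obtain ⟨⟨z, hz⟩, hz'⟩ := QuotientGroup.mk_out_eq_mul (Subgroup.center H) a
      obtain ⟨⟨w, hw⟩, hw'⟩ := QuotientGroup.mk_out_eq_mul (Subgroup.center H) b
      simp only [hz', hw', commutatorElement_def]
      rw [Subgroup.mem_center_iff] at hz hw
      have e1 : ∀ g, z * g = g * z := fun g => (hz g).symm
      have e2 : ∀ g, w * g = g * w := fun g => (hw g).symm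
      have e3 : ∀ g, z⁻¹ * g = g * z⁻¹ := fun g => by rw [inv_mul_eq_iff_eq_mul, ← mul_assoc, e1 g, mul_assoc, mul_inv_cancel, mul_one]
      have e4 : ∀ g, w⁻¹ * g = g * w⁻¹ := fun g => by rw [inv_mul_eq_iff_eq_mul, ← mul_assoc, e2 g, mul_assoc, mul_inv_cancel, mul_one]
      calc a * z * (b * w) * (a * z)⁻¹ * (b * w)⁻¹ 
          = a * (z * b) * (w * (z⁻¹ * a⁻¹)) * (w⁻¹ * b⁻¹) := by group
        _ = a * (b * z) * ((z⁻¹ * a⁻¹) * w) * (w⁻¹ * b⁻¹) := by rw [e1 b, e2]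
        _ = a * b * a⁻¹ * b⁻¹ := by group
    exact (Set.finite_range _).subset hsub
  have hS : (ModularGroup.S : SpecialLinearGroup (Fin 2) ℤ) ^ 4 = 1 := by
    decide
  have hfg : Group.FG (SpecialLinearGroup (Fin 2) ℤ) := by
    rw [Group.fg_iff]
    exact ⟨_, SpecialLinearGroup.SL2Z_generators, by simp⟩
  let ψ : SpecialLinearGroup (Fin 2) ℤ →* Abelianization H := Abelianization.of.comp φ
  have hψ : Function.Surjective ψ := by
    intro x
    obtain ⟨y, rfl⟩ := QuotientGroup.mk_surjective x
    obtain ⟨z, rfl⟩ := hφ y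
    exact ⟨z, rfl⟩
  have : Group.FG (Abelianization H) := Group.fg_of_surjective hψ
  have hab : Finite (Abelianization H) := by
    apply CommGroup.finite_of_fg_isMulTorsion
    intro x
    obtain ⟨y, rfl⟩ := hψ x
    have hy : y ∈ Subgroup.closure {ModularGroup.S, ModularGroup.T} := by
      rw [SpecialLinearGroup.SL2Z_generators]; trivial
    induction hy using Subgroup.closure_induction with
    | mem x hx =>
      rcases hx with rfl | hx
      · exact isOfFinOrder_iff_pow_eq_one.mpr ⟨4, by norm_num, by rw [← map_pow, hS, map_one]⟩
      · rw [Set.mem_singleton_iff] at hx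
        subst hx
        refine isOfFinOrder_iff_pow_eq_one.mpr ⟨m, hm, ?_⟩
        show (Abelianization.of (φ ModularGroup.T)) ^ m = 1
        rw [← map_pow, hT, map_one]
    | one => rw [map_one]; exact IsOfFinOrder.one
    | mul x y _ _ hx hy => rw [map_mul]; exact (Commute.all _ _).isOfFinOrder_mul hx hy
    | inv x _ hx => rw [map_inv]; exact hx.inv
  have : Finite (H ⧸ commutator H) := hab
  exact Finite.of_subgroup_quotient (commutator H)

variable {n : ℕ}

lemma el_eq {i j k : Fin n} (h1 : i ≠ j) (h2 : k ≠ j) (h3 : i ≠ k) (x : ℤ) :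
    el i j x = el i k x * el k j 1 * (el i k x)⁻¹ * (el k j 1)⁻¹ := by
  have := el_comm1 h3 h2 h1 x 1
  rw [mul_one] at this
  rw [this]; group

lemma bet_T {i j : Fin n} (h : i ≠ j) : bet h ModularGroup.T = el i j 1 := by
  rw [← bet_shear h]; rfl

lemma bet_S {i j : Fin n} (h : i ≠ j) :
    bet h ModularGroup.S = el i j (-1) * el j i 1 * el i j (-1) := by
  ext1
  rw [bet_val]
  have e : (ModularGroup.S : SpecialLinearGroup (Fin 2) ℤ).1 = !![0, -1; 1, 0] := rfl
  simp only [Units.val_mul, el_val h, el_val h.symm, blk, e]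
  simp only [add_mul, mul_add, one_mul, mul_one, smul_mul_assoc, mul_smul_comm,
    single_mul_single_same, of_apply, cons_val', cons_val_zero, cons_val_one, cons_val_fin_one,
    single_mul_single_of_ne _ _ _ _ h.symm, single_mul_single_of_ne _ _ _ _ h, smul_zero, mul_zero,
    zero_mul]
  module

lemma el_period {Γ : Type*} [Group Γ] (π : GL (Fin n) ℤ →* Γ) (m : ℕ)
    {i j : Fin n} (h : i ≠ j) (hπ : π (el i j 1) ^ m = 1) (x y : ℤ) (hxy : (x : ZMod m) = y) :
    π (el i j x) = π (el i j y) := by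
  rw [ZMod.intCast_eq_intCast_iff_dvd_sub] at hxy
  obtain ⟨t, ht⟩ := hxy
  have e : el i j y = el i j 1 ^ ((m : ℤ) * t) * el i j x := by
    rw [el_zpow h, ← el_add h]; congr 1; linarith
  rw [e, map_mul, map_zpow, _root_.zpow_mul, zpow_natCast, hπ, _root_.one_zpow, one_mul]

lemma bet_finite {Γ : Type*} [Group Γ] (hn : 3 ≤ n) (π : GL (Fin n) ℤ →* Γ) (m : ℕ) (hm : 0 < m)
    (hπ : ∀ i j, i ≠ j → π (el i j 1) ^ m = 1) {i j : Fin n} (h : i ≠ j) :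
    (Set.range fun A => π (bet h A)).Finite := by
  have : NeZero m := ⟨hm.ne'⟩
  obtain ⟨k, hki, hkj⟩ : ∃ k : Fin n, k ≠ i ∧ k ≠ j := by
    by_contra! hh
    have : (Finset.univ : Finset (Fin n)) ⊆ {i, j} := by
      intro t _
      by_cases ht : t = i
      · simp [ht]
      · simp [hh t ht]
    have h1 := Finset.card_le_card this
    have h2 : ({i, j} : Finset (Fin n)).card ≤ 2 := Finset.card_le_two
    simp at h1
    omega
  let θ := π.comp (bet h)
  have key : ∀ A ∈ CongruenceSubgroup.Gamma m, ∀ B, Commute (θ A) (θ B) := by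
    intro A hA
    rw [CongruenceSubgroup.Gamma_mem] at hA
    obtain ⟨a00, a01, a10, a11⟩ := hA
    have p1 : ∀ {r s : Fin n} (hrs : r ≠ s) (a : ℤ), (a : ZMod m) = 1 →
        π (el r s (a * 1)) = π (el r s 1) := fun hrs a ha =>
      el_period π m hrs (hπ _ _ hrs) _ _ (by push_cast; rw [ha, one_mul])
    have p0 : ∀ {r s : Fin n} (hrs : r ≠ s) (a : ℤ), (a : ZMod m) = 0 →
        π (el r s (a * 1)) = 1 := fun hrs a ha => by
      rw [el_period π m hrs (hπ _ _ hrs) (a * 1) 0 (by push_cast; rw [ha, zero_mul]), el_zero hrs, map_one]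
    have c1 : Commute (θ A) (π (el i k 1)) := by
      have := congrArg π (bet_el1 h hkj.symm hki.symm A 1)
      simp only [map_mul] at this
      rwa [p1 hki.symm _ a00, p0 hkj.symm _ a10, mul_one] at this
    have c2 : Commute (θ A) (π (el j k 1)) := by
      have := congrArg π (bet_el2 h hkj.symm hki.symm A 1)
      simp only [map_mul] at this
      rwa [p0 hki.symm _ a01, p1 hkj.symm _ a11, one_mul] at this
    have c3 : Commute (θ A) (π (el k i 1)) := by
      have := congrArg π (bet_el3 h hkj.symm hki.symm A 1)
      simp only [map_mul] at this
      rw [p1 hki _ a00, p0 hkj _ a01, mul_one] at this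
      exact this.symm
    have c4 : Commute (θ A) (π (el k j 1)) := by
      have := congrArg π (bet_el4 h hkj.symm hki.symm A 1)
      simp only [map_mul] at this
      rw [p0 hki _ a10, p1 hkj _ a11, one_mul] at this
      exact this.symm
    have c5 : Commute (θ A) (π (el i j 1)) := by
      rw [el_eq h hkj hki.symm 1]
      simp only [map_mul, map_inv]
      exact ((c1.mul_right c4).mul_right c1.inv_right).mul_right c4.inv_right
    have c6 : Commute (θ A) (π (el j i 1)) := by
      rw [el_eq h.symm hki hkj.symm 1]
      simp only [map_mul, map_inv]
      exact ((c2.mul_right c3).mul_right c2.inv_right).mul_right c3.inv_right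
    intro B
    have hB : B ∈ Subgroup.closure {ModularGroup.S, ModularGroup.T} := by
      rw [SpecialLinearGroup.SL2Z_generators]; trivial
    induction hB using Subgroup.closure_induction with
    | mem x hx =>
      rcases hx with rfl | hx
      · show Commute _ (π (bet h _))
        rw [bet_S h, el_neg h]
        simp only [map_mul, map_inv]
        exact (c5.inv_right.mul_right c6).mul_right c5.inv_right
      · rw [Set.mem_singleton_iff] at hx
        subst hx
        show Commute _ (π (bet h _))
        rw [bet_T h]; exact c5
    | one => rw [map_one]; exact Commute.one_right _
    | mul x y _ _ hx hy => rw [map_mul]; exact hx.mul_right hy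
    | inv x _ hx => rw [map_inv]; exact hx.inv_right
  have hf : Finite θ.range := by
    refine finite_of_SL2 θ.rangeRestrict θ.rangeRestrict_surjective (CongruenceSubgroup.Gamma m) ?_ m hm ?_
    · intro A hA
      rw [Subgroup.mem_center_iff]
      rintro ⟨_, B, rfl⟩
      exact Subtype.ext (key A hA B).symm
    · apply Subtype.ext
      show (π (bet h _)) ^ m = 1
      rw [bet_T]; exact hπ _ _ h
  exact hf

lemma diag_finite : {g : GL (Fin n) ℤ | ∀ r c, r ≠ c → g.1 r c = 0}.Finite := by
  have hf : (Set.univ.pi fun _ : Fin n => ({1, -1} : Set ℤ)).Finite :=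
    Set.Finite.pi fun _ => Set.toFinite _
  refine Set.Finite.of_finite_image (f := fun g => fun i => g.1 i i) (hf.subset ?_) ?_
  · rintro _ ⟨g, hg, rfl⟩ i _
    have hd : g.1 = diagonal fun i => g.1 i i := by
      ext r c
      by_cases h : r = c
      · subst h; simp
      · rw [diagonal_apply_ne _ h, hg r c h]
    have hu : IsUnit g.1.det := (Matrix.isUnit_iff_isUnit_det _).mp g.isUnit
    rw [hd, det_diagonal, IsUnit.prod_univ_iff] at hu
    simpa using Int.isUnit_iff.mp (hu i)
  · intro g hg g' hg' h
    ext r c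
    by_cases hrc : r = c
    · subst hrc; exact congrFun h r
    · rw [hg r c hrc, hg' r c hrc]

theorem range_finite {Γ : Type*} [Group Γ] (hn : 3 ≤ n) (π : GL (Fin n) ℤ →* Γ) (m : ℕ) (hm : 0 < m)
    (hπ : ∀ i j, i ≠ j → π (el i j 1) ^ m = 1) : (Set.range π).Finite := by
  have := elimination (n := n) (fun P => (π '' {g | P g}).Finite) (diag_finite.image π)
    (fun P Q h hQ => hQ.subset (Set.image_mono h)) ?_
  · simpa using this
  · intro P Q i j h hQ hstep
    refine ((bet_finite hn π m hm hπ h).image (·⁻¹)).mul hQ |>.subset ?_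
    rintro _ ⟨g, hg, rfl⟩
    obtain ⟨A, hA⟩ := hstep g hg
    refine Set.mem_mul.mpr ⟨(π (bet h A))⁻¹, ⟨_, ⟨A, rfl⟩, rfl⟩, π (bet h A * g), ⟨_, hA, rfl⟩, ?_⟩
    simp
end Fin

section G1
open Module Matrix
variable {n : ℕ} {V : Type*} [AddCommGroup V] [Module ℚ V]

lemma gen_top (H : Subgroup (GL (Fin n) ℤ)) (h1 : ∀ i j, i ≠ j → el i j 1 ∈ H)
    (h2 : ∀ g : GL (Fin n) ℤ, (∀ r c, r ≠ c → g.1 r c = 0) → g ∈ H) (g : GL (Fin n) ℤ) : g ∈ H := by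
  refine elimination (n := n) (fun P => ∀ g, P g → g ∈ H) h2 (fun P Q h hQ g hg => hQ g (h g hg)) ?_
    g trivial
  intro P Q i j h hQ hstep g hg
  obtain ⟨A, hA⟩ := hstep g hg
  have hb : bet h A ∈ H := by
    have hB : A ∈ Subgroup.closure {ModularGroup.S, ModularGroup.T} := by
      rw [SpecialLinearGroup.SL2Z_generators]; trivial
    clear hA
    induction hB using Subgroup.closure_induction with
    | mem x hx =>
      rcases hx with rfl | hx
      · rw [bet_S h, el_neg h]
        exact H.mul_mem (H.mul_mem (H.inv_mem (h1 _ _ h)) (h1 _ _ h.symm)) (H.inv_mem (h1 _ _ h))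
      · rw [Set.mem_singleton_iff] at hx
        subst hx
        rw [bet_T h]; exact h1 _ _ h
    | one => rw [map_one]; exact H.one_mem
    | mul x y _ _ hx hy => rw [map_mul]; exact H.mul_mem hx hy
    | inv x _ hx => rw [map_inv]; exact H.inv_mem hx
  exact (Subgroup.mul_mem_cancel_left H hb).mp (hQ _ hA)

lemma unip_pow_fix {T : End ℚ V} (hT : IsNilpotent (T - 1)) {k : ℕ} (hk : 0 < k) {x : V}
    (hx : (T ^ k) x = x) : T x = x := by
  set s := ∑ i ∈ Finset.range k, T ^ i with hs
  have e1 : s * (T - 1) = T ^ k - 1 := geom_sum_mul T k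
  set s2 := ∑ i ∈ Finset.range k, ∑ j ∈ Finset.range i, T ^ j with hs2
  have e2 : s = (T - 1) * s2 + algebraMap ℚ (End ℚ V) k := by
    have : ∀ i, T ^ i = (T - 1) * (∑ j ∈ Finset.range i, T ^ j) + 1 := by
      intro i; rw [mul_geom_sum, sub_add_cancel]
    rw [hs, Finset.sum_congr rfl fun i _ => this i, Finset.sum_add_distrib, ← Finset.mul_sum, ← hs2]
    simp
  have hc : Commute (T - 1) s2 := by
    refine Commute.sum_right _ _ _ fun i _ => Commute.sum_right _ _ _ fun j _ => ?_
    exact ((Commute.refl T).sub_left (Commute.one_left T)).pow_right j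
  have hu : IsUnit s := by
    rw [e2]
    refine IsNilpotent.isUnit_add_right_of_commute (hc.isNilpotent_mul_right hT) ?_ ?_
    · exact (IsUnit.mk0 (k : ℚ) (by exact_mod_cast hk.ne')).map (algebraMap ℚ (End ℚ V))
    · exact (Algebra.commutes _ _).symm
  have h0 : s ((T - 1) x) = 0 := by
    rw [← End.mul_apply, e1, LinearMap.sub_apply, hx, End.one_apply, sub_self]
  have inj := ((End.isUnit_iff s).mp hu).1
  have := inj (h0.trans (map_zero s).symm)
  rwa [LinearMap.sub_apply, End.one_apply, sub_eq_zero] at this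

/-- The stabilizer of a vector. -/
def fixSub {G : Type*} [Group G] (ρ : Representation ℚ G V) (u : V) : Subgroup G where
  carrier := {g | ρ g u = u}
  mul_mem' := by
    intro a b ha hb
    simp only [Set.mem_ofPred_eq] at *
    rw [map_mul, End.mul_apply, hb, ha]
  one_mem' := by simp
  inv_mem' := by
    intro a ha
    simp only [Set.mem_ofPred_eq] at *
    nth_rewrite 1 [← ha]
    rw [← End.mul_apply, ← map_mul, inv_mul_cancel, map_one, End.one_apply]

lemma mem_fixSub {G : Type*} [Group G] {ρ : Representation ℚ G V} {u : V} {g : G} :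
    g ∈ fixSub ρ u ↔ ρ g u = u := Iff.rfl

lemma conj_fix {G : Type*} [Group G] {ρ : Representation ℚ G V} {u : V} {g a w : G}
    (h : a * g = g * w) (hw : w ∈ fixSub ρ u) : a ∈ fixSub ρ (ρ g u) := by
  rw [mem_fixSub] at *
  rw [← End.mul_apply, ← map_mul, h, map_mul, End.mul_apply, hw]

/-- Vectors fixed by all `m`-th powers of elementary matrices. -/
def UU (ρ : Representation ℚ (GL (Fin n) ℤ) V) (m : ℕ) : Submodule ℚ V where
  carrier := {u | ∀ i j, i ≠ j → ρ (el i j m) u = u}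
  add_mem' := by
    intro a b ha hb i j h
    rw [map_add, ha i j h, hb i j h]
  zero_mem' := by intro i j _; rw [map_zero]
  smul_mem' := by
    intro c a ha i j h
    rw [map_smul, ha i j h]

lemma UU_stable (hn : 3 ≤ n) (ρ : Representation ℚ (GL (Fin n) ℤ) V) (m : ℕ) (hm : 0 < m)
    (hu : ∀ i j, i ≠ j → IsNilpotent (ρ (el i j m) - 1)) (g : GL (Fin n) ℤ) :
    ∀ u ∈ UU ρ m, ρ g u ∈ UU ρ m := by
  have hz : ∀ u ∈ UU ρ m, ∀ i j, i ≠ j → ∀ x : ℤ, el i j (x * m) ∈ fixSub ρ u := by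
    intro u hu i j h x
    rw [← el_zpow h]
    exact (fixSub ρ u).zpow_mem (hu i j h) x
  have hel : ∀ a b, a ≠ b → ∀ x, ∀ u ∈ UU ρ m, ρ (el a b x) u ∈ UU ρ m := by
    intro a b hab x u hU
    have c1 : ∀ i j, i ≠ j → j ≠ a → i ≠ b → el i j m ∈ fixSub ρ (ρ (el a b x) u) := by
      intro i j hij h1 h2
      exact conj_fix (el_comm2 hij hab h1 h2 _ _).eq (hU i j hij)
    have c2 : ∀ i, i ≠ a → i ≠ b → el i a m ∈ fixSub ρ (ρ (el a b x) u) := by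
      intro i h1 h2
      refine conj_fix (w := el i b (x * m) * el i a m) ?_
        ((fixSub ρ u).mul_mem (hz u hU i b h2 x) (hU i a h1))
      rw [el_comm1 h1 hab h2, (el_comm2 h2 hab hab.symm h2 _ _).eq, mul_assoc, mul_comm (m : ℤ)]
    have c3 : ∀ j, j ≠ a → j ≠ b → el b j m ∈ fixSub ρ (ρ (el a b x) u) := by
      intro j h1 h2
      refine conj_fix (w := (el a j (x * m))⁻¹ * el b j m) ?_
        ((fixSub ρ u).mul_mem ((fixSub ρ u).inv_mem (hz u hU a j h1.symm x)) (hU b j h2.symm))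
      have e := el_comm1 hab h2.symm h1.symm x m
      have e2 := (el_comm2 h1.symm hab h1 hab (x * m) x)
      rw [← mul_assoc, ← e2.inv_left.eq, mul_assoc, e]
      group
    intro i j hij
    by_cases h1 : j = a
    · subst h1
      by_cases h2 : i = b
      · subst h2
        obtain ⟨k, hki, hkj⟩ : ∃ k : Fin n, k ≠ i ∧ k ≠ j := by
          by_contra! hh
          have : (Finset.univ : Finset (Fin n)) ⊆ {i, j} := by
            intro t _
            by_cases ht : t = i
            · simp [ht]
            · simp [hh t ht]
          have h1 := Finset.card_le_card this
          have h2 : ({i, j} : Finset (Fin n)).card ≤ 2 := Finset.card_le_two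
          simp at h1
          omega
        refine unip_pow_fix (hu i j hij) hm ?_
        rw [← map_pow, el_pow hij]
        have e : el i j ((m : ℤ) * m) = el i k m * el k j m * (el i k m)⁻¹ * (el k j m)⁻¹ := by
          rw [el_comm1 hki.symm hkj hij]; group
        rw [e]
        have m1 := c3 k hkj hki
        have m2 := c2 k hkj hki
        exact mul_mem (mul_mem (mul_mem m1 m2) (inv_mem m1)) (inv_mem m2)
      · exact c2 i hij h2
    · by_cases h2 : i = b
      · subst h2
        exact c3 j h1 hij.symm
      · exact c1 i j hij h1 h2
  have hdg : ∀ d : GL (Fin n) ℤ, (∀ r c, r ≠ c → d.1 r c = 0) → 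
      (∀ u ∈ UU ρ m, ρ d u ∈ UU ρ m) ∧ d⁻¹ = d := by
    intro d hd
    have hd1 : d.1 = diagonal fun i => d.1 i i := by
      ext r c
      by_cases h : r = c
      · subst h; simp
      · rw [diagonal_apply_ne _ h, hd r c h]
    have hsq : ∀ i, d.1 i i * d.1 i i = 1 := by
      have hu : IsUnit d.1.det := (Matrix.isUnit_iff_isUnit_det _).mp d.isUnit
      rw [hd1, det_diagonal, IsUnit.prod_univ_iff] at hu
      exact fun i => Int.isUnit_mul_self (hu i)
    constructor
    · intro u hU i j hij
      refine conj_fix (w := el i j ((d.1 i i * d.1 j j) * m)) ?_ (hz u hU i j hij _)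
      ext1
      rw [Units.val_mul, Units.val_mul, el_val hij, el_val hij, add_mul, mul_add, one_mul, mul_one,
        smul_mul_assoc, mul_smul_comm]
      congr 1
      have e1 : single i j (1 : ℤ) * d.1 = d.1 j j • single i j 1 := by
        rw [hd1]; ext r c; simp [mul_diagonal, single_apply]
        split_ifs with h
        · rw [h.2]
        · rfl
      have e2 : d.1 * single i j (1 : ℤ) = d.1 i i • single i j 1 := by
        rw [hd1]; ext r c; simp [diagonal_mul, single_apply]
        split_ifs with h
        · rw [h.1]
        · rfl
      rw [e1, e2, smul_smul, smul_smul]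
      congr 1
      linear_combination (-(m : ℤ) * d.1 j j) * hsq i
    · rw [inv_eq_iff_mul_eq_one]
      ext1
      rw [Units.val_mul, hd1, diagonal_mul_diagonal]
      simp [hsq]
  let H : Subgroup (GL (Fin n) ℤ) :=
    { carrier := {g | (∀ u ∈ UU ρ m, ρ g u ∈ UU ρ m) ∧ (∀ u ∈ UU ρ m, ρ g⁻¹ u ∈ UU ρ m)}
      mul_mem' := by
        rintro a b ⟨ha, ha'⟩ ⟨hb, hb'⟩
        refine ⟨fun u hu => ?_, fun u hu => ?_⟩
        · rw [map_mul, End.mul_apply]; exact ha _ (hb _ hu)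
        · rw [_root_.mul_inv_rev, map_mul, End.mul_apply]; exact hb' _ (ha' _ hu)
      one_mem' := by simp
      inv_mem' := by
        rintro a ⟨ha, ha'⟩
        exact ⟨ha', by rwa [inv_inv]⟩ }
  have hH : g ∈ H := by
    refine gen_top H ?_ ?_ g
    · intro i j hij
      refine ⟨hel i j hij 1, ?_⟩
      rw [← el_neg hij]
      exact hel i j hij (-1)
    · intro d hd
      obtain ⟨h1, h2⟩ := hdg d hd
      exact ⟨h1, by rwa [h2]⟩
  exact hH.1

lemma orbit_finite (hn : 3 ≤ n) (ρ : Representation ℚ (GL (Fin n) ℤ) V) (m : ℕ) (hm : 0 < m)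
    (hu : ∀ i j, i ≠ j → IsNilpotent (ρ (el i j m) - 1)) (u : V) (hU : u ∈ UU ρ m) :
    (Set.range fun g => ρ g u).Finite := by
  have hst := UU_stable hn ρ m hm hu
  let σ : GL (Fin n) ℤ →* End ℚ (UU ρ m) :=
    { toFun := fun g => (ρ g).restrict (hst g)
      map_one' := by ext x; simp
      map_mul' := by intro a b; ext x; simp }
  have := range_finite hn σ.toHomUnits m hm ?_
  · refine (this.image fun e => ((e.1 ⟨u, hU⟩ : UU ρ m) : V)).subset ?_
    rintro _ ⟨g, rfl⟩
    exact ⟨_, ⟨g, rfl⟩, rfl⟩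
  · intro i j h
    rw [← map_pow, el_pow h, mul_one]
    ext x
    exact x.2 i j h

lemma average {G : Type*} [Group G] (ρ : Representation ℚ G V) (u : V)
    (hfin : (Set.range fun g => ρ g u).Finite) {W : Type*} [AddCommGroup W] [Module ℚ W]
    (f : V →ₗ[ℚ] W) (w : W) (hf : ∀ g, f (ρ g u) = w) : ∃ v ∈ ρ.invariants, f v = w := by
  classical
  set O := hfin.toFinset with hO
  have hmem : ∀ x, x ∈ O ↔ ∃ g, ρ g u = x := by intro x; simp [hO]
  have hne : (O.card : ℚ) ≠ 0 := by
    have : O.Nonempty := ⟨u, (hmem u).mpr ⟨1, by simp⟩⟩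
    exact_mod_cast this.card_pos.ne'
  refine ⟨(O.card : ℚ)⁻¹ • ∑ x ∈ O, x, ?_, ?_⟩
  · rw [Representation.mem_invariants]
    intro g
    rw [map_smul, map_sum]
    congr 1
    refine Finset.sum_bij' (fun x _ => ρ g x) (fun x _ => ρ g⁻¹ x) ?_ ?_ ?_ ?_ ?_
    · intro x hx
      obtain ⟨h, rfl⟩ := (hmem x).mp hx
      exact (hmem _).mpr ⟨g * h, by simp⟩
    · intro x hx
      obtain ⟨h, rfl⟩ := (hmem x).mp hx
      exact (hmem _).mpr ⟨g⁻¹ * h, by simp⟩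
    · intro x _; simp
    · intro x _; simp
    · intro x _; rfl
  · rw [map_smul, map_sum, Finset.sum_congr rfl (g := fun _ => w)]
    · rw [Finset.sum_const, ← Nat.cast_smul_eq_nsmul ℚ, smul_smul, inv_mul_cancel₀ hne, one_smul]
    · intro x hx
      obtain ⟨h, rfl⟩ := (hmem x).mp hx
      exact hf h
end G1

section G2
attribute [local instance] LieRing.ofAssociativeRing
open Module Matrix Polynomial
variable {n : ℕ}

lemma fitting {M : Type*} [AddCommGroup M] [Module ℚ M] [FiniteDimensional ℚ M] (C : End ℚ M) :
    ∃ p : ℚ[X], (1 + C * aeval C p) * (1 + C * aeval C p) = 1 + C * aeval C p ∧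
      IsNilpotent (C * (1 + C * aeval C p)) := by
  have h0 : C.charpoly ≠ 0 := C.charpoly_monic.ne_zero
  obtain ⟨q, hq, hnd⟩ := Polynomial.exists_eq_pow_rootMultiplicity_mul_and_not_dvd _ h0 (0 : ℚ)
  generalize C.charpoly.rootMultiplicity 0 = N at hq
  rw [C_0, sub_zero] at hq hnd
  have hcop : IsCoprime ((X : ℚ[X]) ^ (N + 1)) q :=
    ((Polynomial.irreducible_X.coprime_iff_not_dvd).mpr hnd).pow_left
  obtain ⟨a, b, hab⟩ := hcop
  have hCH : aeval C (X ^ N * q) = 0 := by rw [← hq]; exact C.aeval_self_charpoly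
  have hP : aeval C (b * q) = 1 + C * aeval C (-(a * X ^ N)) := by
    have : b * q = 1 + X * (-(a * X ^ N)) := by rw [← hab]; ring
    rw [this]; simp
  refine ⟨-(a * X ^ N), ?_, N + 1, ?_⟩
  · rw [← hP, ← map_mul]
    have : b * q * (b * q) = b * q - a * b * X * (X ^ N * q) := by
      have : b * q * (b * q) = b * q * (1 - a * X ^ (N + 1)) := by rw [← hab]; ring
      rw [this]; ring
    rw [this, map_sub, map_mul _ _ (X ^ N * q), hCH, mul_zero, sub_zero]
  · rw [← hP]
    have : C * aeval C (b * q) = aeval C (X * (b * q)) := by simp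
    rw [this, ← map_pow]
    have : (X * (b * q)) ^ (N + 1) = (X * b * (b * q) ^ N) * (X ^ N * q) := by ring
    rw [this, map_mul, hCH, mul_zero]

lemma commute_aeval {A : Type*} [Ring A] [Algebra ℚ A] {x y : A} (h : Commute x y) (p : ℚ[X]) :
    Commute x (aeval y p) := by
  rw [aeval_eq_sum_range]
  exact Commute.sum_right _ _ _ fun k _ => (h.pow_right k).smul_right _

lemma casimir_mul {A : Type*} [Ring A] [Algebra ℚ A] {X : Fin n → Fin n → A} (hX : SteinRel X)
    {P : A} (hP : P * P = P) (hc : ∀ i j, Commute (X i j) P) :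
    SteinRel (fun i j => X i j * P) ∧ casimir (fun i j => X i j * P) = casimir X * P := by
  have hl : ∀ a b : A, Commute a P → Commute b P → (a * P) * (b * P) = (a * b) * P := by
    intro a b ha hb
    rw [mul_assoc, ← mul_assoc P, ← hb.eq, mul_assoc b, hP, mul_assoc]
  have hl2 : ∀ a b : A, Commute a P → Commute b P → ⁅a * P, b * P⁆ = ⁅a, b⁆ * P := by
    intro a b ha hb
    rw [Ring.lie_def, Ring.lie_def, hl a b ha hb, hl b a hb ha, sub_mul]
  have hHc : ∀ i j, Commute (HH X i j) P := by
    intro i j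
    rw [HH, Ring.lie_def]
    exact ((hc i j).mul_left (hc j i)).sub_left ((hc j i).mul_left (hc i j))
  have hDc : ∀ i, Commute (DD X i) P := by
    intro i
    exact (Commute.sum_left _ _ _ fun j _ => hHc i j).smul_left _
  have hEc : ∀ i j, Commute (EE X i j) P := by
    intro i j
    rw [EE]
    split_ifs
    · exact hDc i
    · exact hc i j
  have hE : ∀ i j, EE (fun i j => X i j * P) i j = EE X i j * P := by
    intro i j
    rw [EE, EE]
    split_ifs
    · rw [DD, DD, smul_mul_assoc, Finset.sum_mul]
      congr 1
      exact Finset.sum_congr rfl fun j _ => hl2 _ _ (hc _ _) (hc _ _)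
    · rfl
  refine ⟨⟨?_, ?_⟩, ?_⟩
  · intro i j k h1 h2 h3
    rw [hl2 _ _ (hc _ _) (hc _ _), hX.s1 i j k h1 h2 h3]
  · intro i j k l h1 h2 h3 h4
    rw [hl2 _ _ (hc _ _) (hc _ _), hX.s2 i j k l h1 h2 h3 h4, zero_mul]
  · simp only [casimir, hE, Finset.sum_mul]
    refine Finset.sum_congr rfl fun i _ => Finset.sum_congr rfl fun j _ => ?_
    exact hl _ _ (hEc _ _) (hEc _ _)

section
variable {V W : Type*} [AddCommGroup V] [Module ℚ V] [AddCommGroup W] [Module ℚ W]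

/-- Operators sending every vector over the line of `w` to the kernel of `f`. -/
def JJ (f : V →ₗ[ℚ] W) (w : W) : Submodule ℚ (End ℚ V) where
  carrier := {B | ∀ u, (∃ c : ℚ, f u = c • w) → f (B u) = 0}
  add_mem' := by
    intro a b ha hb u hu
    rw [LinearMap.add_apply, map_add, ha u hu, hb u hu, add_zero]
  zero_mem' := by intro u _; simp
  smul_mem' := by
    intro c a ha u hu
    rw [LinearMap.smul_apply, map_smul, ha u hu, smul_zero]

lemma JJ_mul {f : V →ₗ[ℚ] W} {w : W} {A B : End ℚ V} (hA : A ∈ JJ f w) (hB : B ∈ JJ f w) :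
    A * B ∈ JJ f w := by
  intro u hu
  exact hA _ ⟨0, by rw [hB u hu, zero_smul]⟩

lemma JJ_aeval {f : V →ₗ[ℚ] W} {w : W} {A : End ℚ V} (hA : A ∈ JJ f w) (p : ℚ[X]) :
    A * aeval A p ∈ JJ f w := by
  have hp : ∀ k : ℕ, A ^ (k + 1) ∈ JJ f w := by
    intro k
    induction k with
    | zero => simpa using hA
    | succ k ih => rw [pow_succ]; exact JJ_mul ih hA
  rw [aeval_eq_sum_range, Finset.mul_sum]
  refine Submodule.sum_mem _ fun k _ => ?_
  rw [mul_smul_comm, ← pow_succ']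
  exact Submodule.smul_mem _ _ (hp k)

lemma JJ_casimir {f : V →ₗ[ℚ] W} {w : W} {X : Fin n → Fin n → End ℚ V}
    (hX : ∀ i j, X i j ∈ JJ f w) : casimir X ∈ JJ f w := by
  have hE : ∀ i j, EE X i j ∈ JJ f w := by
    intro i j
    rw [EE]
    split_ifs
    · refine Submodule.smul_mem _ _ (Submodule.sum_mem _ fun j _ => ?_)
      rw [HH, Ring.lie_def]
      exact Submodule.sub_mem _ (JJ_mul (hX _ _) (hX _ _)) (JJ_mul (hX _ _) (hX _ _))
    · exact hX i j
  exact Submodule.sum_mem _ fun i _ => Submodule.sum_mem _ fun j _ => JJ_mul (hE _ _) (hE _ _)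
end

lemma unip {V : Type*} [AddCommGroup V] [Module ℚ V] [FiniteDimensional ℚ V] (hn : 3 ≤ n)
    (ρ : Representation ℚ (GL (Fin n) ℤ) V) (i j : Fin n) (hij : i ≠ j) :
    IsNilpotent (ρ (el i j ((finrank ℚ V).factorial : ℕ)) - 1) := by
  obtain ⟨k, hki, hkj⟩ := exists_third hn i j
  have := quasi_unip (T := ρ (el i j 1)) (A := ρ (el i k 1)) (B := ρ (el k j 1))
    ((Group.isUnit _).map ρ) ((Group.isUnit _).map ρ)
    ((el_comm2 hij hki.symm hij.symm hki.symm 1 1).map ρ)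
    ((el_comm2 hij hkj hkj.symm hij 1 1).map ρ)
    (by rw [← map_mul, el_comm1 hki.symm hkj hij, map_mul, map_mul, mul_one])
  rwa [← map_pow, el_pow hij, mul_one] at this

lemma logs {V : Type*} [AddCommGroup V] [Module ℚ V]
    (ρ : Representation ℚ (GL (Fin n) ℤ) V) (m : ℕ) (hm : 0 < m)
    (hu : ∀ i j, i ≠ j → IsNilpotent (ρ (el i j m) - 1)) :
    ∃ X : Fin n → Fin n → End ℚ V, SteinRel X ∧ (∀ i, X i i = 0) ∧
      ∀ i j, i ≠ j → ∃ r : ℚ[X], X i j = (m : ℚ)⁻¹ • ((ρ (el i j m) - 1) +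
        (ρ (el i j m) - 1) * (ρ (el i j m) - 1) * aeval (ρ (el i j m) - 1) r) := by
  have hex : ∀ i j, ∃ Y : End ℚ V, i ≠ j → (PolyFun (fun t => (ρ (el i j m)) ^ t) 1 Y ∧
      ∃ r : ℚ[X], Y = ((ρ (el i j m) - 1) +
        (ρ (el i j m) - 1) * (ρ (el i j m) - 1) * aeval (ρ (el i j m) - 1) r)) := by
    intro i j
    by_cases h : i = j
    · exact ⟨0, fun h' => absurd h h'⟩
    · obtain ⟨r, hr⟩ := PolyFun.exists_log _ (hu i j h)
      rw [add_sub_cancel] at hr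
      exact ⟨_, fun _ => ⟨hr, r, rfl⟩⟩
  choose Y hY using hex
  have hm0 : (m : ℚ) ≠ 0 := by exact_mod_cast hm.ne'
  refine ⟨fun i j => if i = j then 0 else (m : ℚ)⁻¹ • Y i j, ⟨?_, ?_⟩, by simp, ?_⟩
  · intro i j k h1 h2 h3
    have := PolyFun.log_comm m (hY i j h1).1 (hY j k h2).1 (hY i k h3).1 (by
      intro a b
      simp only [← map_pow, ← map_mul]
      rw [el_pow h1, el_pow h2, el_pow h3, el_comm1 h1 h2 h3]
      congr 3
      push_cast; ring_nf)
    simp only [if_neg h1, if_neg h2, if_neg h3]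
    rw [Ring.lie_def, smul_mul_smul_comm, smul_mul_smul_comm, this, smul_add, add_sub_cancel_right,
      ← nsmul_eq_mul, ← Nat.cast_smul_eq_nsmul ℚ, smul_smul]
    congr 1
    field_simp
  · intro i j k l h1 h2 h3 h4
    have := PolyFun.log_comm 0 (hY i j h1).1 (hY k l h2).1 (hY k l h2).1 (by
      intro a b
      simp only [zero_mul, pow_zero, one_mul, ← map_pow, ← map_mul]
      rw [el_pow h1, el_pow h2, (el_comm2 h1 h2 h3 h4 _ _).eq])
    simp only [if_neg h1, if_neg h2]
    rw [Ring.lie_def, smul_mul_smul_comm, smul_mul_smul_comm, this]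
    simp
  · intro i j h
    obtain ⟨r, hr⟩ := (hY i j h).2
    exact ⟨r, by simp only [if_neg h]; rw [← hr]⟩

theorem main_thm (hn : 3 ≤ n) {V W : Type*} [AddCommGroup V] [Module ℚ V]
    [FiniteDimensional ℚ V] [AddCommGroup W] [Module ℚ W]
    (ρV : Representation ℚ (GL (Fin n) ℤ) V) (ρW : Representation ℚ (GL (Fin n) ℤ) W)
    (f : V →ₗ[ℚ] W) (hf : ∀ (γ : GL (Fin n) ℤ) (v : V), f (ρV γ v) = ρW γ (f v))
    (hsurj : Function.Surjective f) : ∀ w ∈ ρW.invariants, ∃ v ∈ ρV.invariants, f v = w := by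
  intro w hw
  rw [Representation.mem_invariants] at hw
  obtain ⟨v, hv⟩ := hsurj w
  have hm : 0 < (finrank ℚ V).factorial := Nat.factorial_pos _
  have hu := unip hn ρV
  generalize (finrank ℚ V).factorial = m at hm hu
  obtain ⟨X, hX, hX0, hXr⟩ := logs ρV m hm hu
  have hm0 : (m : ℚ) ≠ 0 := by exact_mod_cast hm.ne'
  have hcN : ∀ (N : End ℚ V) (r : ℚ[X]), Commute N (aeval N r) := fun N r =>
    commute_aeval (Commute.refl N) r
  have hnil : ∀ i j, IsNilpotent (X i j) := by
    intro i j
    by_cases h : i = j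
    · rw [h, hX0]; exact IsNilpotent.zero
    obtain ⟨r, hr⟩ := hXr i j h
    rw [hr]
    generalize hN : ρV (el i j m) - 1 = N
    have hNn : IsNilpotent N := hN ▸ hu i j h
    have : (m : ℚ)⁻¹ • (N + N * N * aeval N r) = N * ((m : ℚ)⁻¹ • (1 + N * aeval N r)) := by
      rw [mul_smul_comm, mul_add, mul_one, mul_assoc]
    rw [this]
    refine Commute.isNilpotent_mul_right ?_ hNn
    exact ((Commute.one_right N).add_right ((Commute.refl N).mul_right (hcN N r))).smul_right _
  have hJ : ∀ i j, X i j ∈ JJ f w := by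
    intro i j
    by_cases h : i = j
    · rw [h, hX0]; exact Submodule.zero_mem _
    obtain ⟨r, hr⟩ := hXr i j h
    have hNJ : ρV (el i j m) - 1 ∈ JJ f w := by
      rintro u ⟨c, hc⟩
      rw [LinearMap.sub_apply, map_sub, hf, hc, map_smul, hw, End.one_apply, hc, sub_self]
    rw [hr, mul_assoc]
    exact Submodule.smul_mem _ _ (Submodule.add_mem _ hNJ (JJ_mul hNJ (JJ_aeval hNJ r)))
  obtain ⟨p, hPP, hCP⟩ := fitting (casimir X)
  have hPJ : casimir X * aeval (casimir X) p ∈ JJ f w := JJ_aeval (JJ_casimir hJ) p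
  have hcX : ∀ i j, Commute (X i j) (casimir X) := by
    intro i j
    by_cases h : i = j
    · rw [h, hX0]; exact Commute.zero_left _
    · exact casimir_comm hn hX i j h
  have hcP : ∀ i j, Commute (X i j) (1 + casimir X * aeval (casimir X) p) := by
    intro i j
    refine (Commute.one_right _).add_right ((hcX i j).mul_right ?_)
    exact commute_aeval (hcX i j) p
  obtain ⟨hS, hSc⟩ := casimir_mul hX hPP hcP
  have hz := sln_trivial hn hS (fun i j _ => Commute.isNilpotent_mul_right (hcP i j) (hnil i j))
    (by rw [hSc]; exact hCP)
  set v0 := (1 + casimir X * aeval (casimir X) p) v with hv0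
  have hfv0 : f v0 = w := by
    rw [hv0, LinearMap.add_apply, map_add, hPJ v ⟨1, by rw [hv, one_smul]⟩, End.one_apply, hv,
      add_zero]
  have hXv : ∀ i j, i ≠ j → X i j v0 = 0 := fun i j h => LinearMap.congr_fun (hz i j h) v
  have hU : v0 ∈ UU ρV m := by
    intro i j h
    obtain ⟨r, hr⟩ := hXr i j h
    have h1 := hXv i j h
    rw [hr] at h1
    have hNn := hu i j h
    rw [← sub_eq_zero]
    change (ρV (el i j m) - 1) v0 = 0
    generalize ρV (el i j m) - 1 = N at *
    have e : N + N * N * aeval N r = (1 + N * aeval N r) * N := by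
      rw [add_mul, one_mul, mul_assoc, mul_assoc, (hcN N r).eq]
    rw [LinearMap.smul_apply, smul_eq_zero_iff_right (inv_ne_zero hm0), e, End.mul_apply] at h1
    have hunit : IsUnit (1 + N * aeval N r) :=
      (Commute.isNilpotent_mul_right (hcN N r) hNn).isUnit_one_add
    have := ((End.isUnit_iff _).mp hunit).1
    exact this (by rw [h1, map_zero])
  refine average ρV v0 (orbit_finite hn ρV m hm hu v0 hU) f w fun g => ?_
  rw [hf, hfv0, hw]
end G2

/-!
Statement 8: For `n ≥ 3`, taking `GL_n(ℤ)`-invariants is exact on finite-dimensional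
ℚ-linear representations: any surjective equivariant map `f : V → W` restricts to a
surjection `V^{GL_n(ℤ)} → W^{GL_n(ℤ)}` on invariants.
-/

theorem statement_8 (n : ℕ) (hn : 3 ≤ n)
    (V W : Type) [AddCommGroup V] [Module ℚ V] [FiniteDimensional ℚ V]
    [AddCommGroup W] [Module ℚ W] [FiniteDimensional ℚ W]
    (ρV : Representation ℚ (GL (Fin n) ℤ) V)
    (ρW : Representation ℚ (GL (Fin n) ℤ) W)
    (f : V →ₗ[ℚ] W)
    (hf : ∀ (γ : GL (Fin n) ℤ) (v : V), f (ρV γ v) = ρW γ (f v))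
    (hsurj : Function.Surjective f) :
    ∀ w ∈ ρW.invariants, ∃ v ∈ ρV.invariants, f v = w := by
  exact main_thm hn ρV ρW f hf hsurj
end

section
/- Let f : ¹E → ²E be a morphism of first-quadrant cohomological spectral sequences and let k ≥ 1 be an integer such that ¹E_{k+1}^{k+1,0} = 0. If f_2^{p,k−p} is surjective for all 1 ≤ p ≤ k−1 and f_2^{p,k+1−p} is injective for all p ≥ 2, then the sequence 0 → ¹E_2^{k+1,0} → ²E_2^{k+1,0} → ²E_{k+1}^{k+1,0} → 0 is exact, where the first map is f_2^{k+1,0} and the second is the edge homomorphism; in particular f_2^{k+1,0} is injective and the edge homomorphism ²E_2^{k+1,0} → ²E_{k+1}^{k+1,0} is surjective with kernel the image of f_2^{k+1,0}. -/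
/-!
Statement 11: exactness of `0 → ¹E_2^{k+1,0} → ²E_2^{k+1,0} → ²E_{k+1}^{k+1,0} → 0`.
-/

universe u

/-- The underlying data of a first-quadrant cohomological spectral sequence of ℚ-vector
spaces, starting at page `2`: pages `E r p q` (only the pages with `r ≥ 2` are relevant),
differentials `d_r : E_r^{p,q} → E_r^{p+r,q-r+1}` squaring to zero, and vanishing outside
the first quadrant. -/
structure FQSSAux where
  E : ℤ → ℤ → ℤ → Type u
  [addCommGroup : ∀ r p q, AddCommGroup (E r p q)]
  [module : ∀ r p q, Module ℚ (E r p q)]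
  d : ∀ r p q : ℤ, E r p q →ₗ[ℚ] E r (p + r) (q - r + 1)
  d_comp_d : ∀ r p q : ℤ, (d r (p + r) (q - r + 1)).comp (d r p q) = 0
  firstQuadrant : ∀ r p q : ℤ, (p < 0 ∨ q < 0) → ∀ x : E r p q, x = 0

attribute [instance] FQSSAux.addCommGroup FQSSAux.module

namespace FQSSAux

variable (S : FQSSAux)

/-- Transport between pages along equalities of the indices. -/
def castE {r p q r' p' q' : ℤ} (hr : r = r') (hp : p = p') (hq : q = q') :
    S.E r p q ≃ₗ[ℚ] S.E r' p' q' := by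
  subst hr; subst hp; subst hq; exact LinearEquiv.refl ℚ _

/-- The cycles at position `(p,q)` of page `r`. -/
def cycles (r p q : ℤ) : Submodule ℚ (S.E r p q) := LinearMap.ker (S.d r p q)

/-- The boundaries at position `(p,q)` of page `r`: the image of the incoming
differential `d_r : E_r^{p-r,q+r-1} → E_r^{p,q}`. -/
def boundaries (r p q : ℤ) : Submodule ℚ (S.E r p q) :=
  LinearMap.range ((S.castE rfl (by ring) (by ring) :
      S.E r (p - r + r) (q + r - 1 - r + 1) ≃ₗ[ℚ] S.E r p q).toLinearMap ∘ₗ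
    S.d r (p - r) (q + r - 1))

/-- The homology `ker(d_r^{p,q}) / im(d_r^{p-r,q+r-1})` at position `(p,q)` of page `r`. -/
def homology (r p q : ℤ) : Type u :=
  ↥(S.cycles r p q) ⧸ (S.boundaries r p q).comap (S.cycles r p q).subtype

instance (r p q : ℤ) : AddCommGroup (S.homology r p q) :=
  inferInstanceAs (AddCommGroup (↥(S.cycles r p q) ⧸
    (S.boundaries r p q).comap (S.cycles r p q).subtype))

instance (r p q : ℤ) : Module ℚ (S.homology r p q) :=
  inferInstanceAs (Module ℚ (↥(S.cycles r p q) ⧸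
    (S.boundaries r p q).comap (S.cycles r p q).subtype))

/-- The class in homology of a cycle. -/
def homologyMk (r p q : ℤ) (x : S.E r p q) (hx : x ∈ S.cycles r p q) :
    S.homology r p q :=
  Submodule.Quotient.mk (⟨x, hx⟩ : ↥(S.cycles r p q))

end FQSSAux

/-- A first-quadrant cohomological spectral sequence of ℚ-vector spaces starting at page 2:
the underlying data together with identifications of each page `r + 1` (for `r ≥ 2`) with
the homology of page `r`. -/
structure FQSS extends FQSSAux.{u} where
  next : ∀ r p q : ℤ, 2 ≤ r →
    toFQSSAux.E (r + 1) p q ≃ₗ[ℚ] toFQSSAux.homology r p q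


/-- A morphism of first-quadrant cohomological spectral sequences: maps of pages commuting
with the differentials, such that the map on page `r + 1` is the one induced on homology by
the map on page `r`. -/
structure FQSSHom (A B : FQSS) where
  f : ∀ r p q : ℤ, A.E r p q →ₗ[ℚ] B.E r p q
  comm : ∀ r p q : ℤ,
    (f r (p + r) (q - r + 1)).comp (A.d r p q) = (B.d r p q).comp (f r p q)
  compat : ∀ (r p q : ℤ) (hr : 2 ≤ r) (x : A.E r p q) (hx : x ∈ A.cycles r p q),
    f (r + 1) p q ((A.next r p q hr).symm (A.homologyMk r p q x hx)) =
      (B.next r p q hr).symm (B.homologyMk r p q (f r p q x) (by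
        have h : (B.d r p q) (f r p q x) = (f r (p + r) (q - r + 1)) (A.d r p q x) := by
          have h' := congrArg
            (fun g : A.E r p q →ₗ[ℚ] B.E r (p + r) (q - r + 1) => g x) (comm r p q)
          simpa [LinearMap.comp_apply] using h'.symm
        have hx0 : A.d r p q x = 0 := hx
        show f r p q x ∈ LinearMap.ker (B.d r p q)
        rw [LinearMap.mem_ker, h, hx0, map_zero]))

namespace FQSS

/-- One step of the edge quotient map on the bottom row: since all differentials leaving
the bottom row vanish, `E_{r+1}^{p,0}` is a quotient of `E_r^{p,0}`. -/
noncomputable def edgeStep (S : FQSS) (r p : ℤ) (hr : 2 ≤ r) :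
    S.E r p 0 →ₗ[ℚ] S.E (r + 1) p 0 :=
  (S.next r p 0 hr).symm.toLinearMap ∘ₗ
    (Submodule.mkQ ((S.boundaries r p 0).comap (S.cycles r p 0).subtype)) ∘ₗ
    LinearMap.codRestrict (S.cycles r p 0) LinearMap.id (fun x => by
      show LinearMap.id x ∈ LinearMap.ker (S.d r p 0)
      rw [LinearMap.mem_ker]
      exact S.firstQuadrant r (p + r) (0 - r + 1) (Or.inr (by linarith)) _)

/-- The iterated edge map `E_2^{p,0} → E_{2+m}^{p,0}` on the bottom row. -/
noncomputable def edgeFromNat (S : FQSS) (p : ℤ) :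
    (m : ℕ) → (S.E 2 p 0 →ₗ[ℚ] S.E (2 + (m : ℤ)) p 0)
  | 0 => (S.castE (by norm_num) rfl rfl).toLinearMap
  | (m + 1) =>
      (S.castE (by push_cast; ring) rfl rfl).toLinearMap ∘ₗ
        (S.edgeStep (2 + (m : ℤ)) p (by omega)) ∘ₗ S.edgeFromNat p m

/-- The edge homomorphism `E_2^{p,0} → E_r^{p,0}` (for `r ≥ 2`) on the bottom row: the
composite of the quotient maps `E_s^{p,0} → E_{s+1}^{p,0}` for `2 ≤ s < r`. -/
noncomputable def edge (S : FQSS) (p r : ℤ) (hr : 2 ≤ r) :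
    S.E 2 p 0 →ₗ[ℚ] S.E r p 0 :=
  (S.castE (by omega) rfl rfl :
      S.E (2 + (((r - 2).toNat : ℕ) : ℤ)) p 0 ≃ₗ[ℚ] S.E r p 0).toLinearMap ∘ₗ
    S.edgeFromNat p (r - 2).toNat

end FQSS

theorem FQSSHom.f_castE {A B : FQSS} (φ : FQSSHom A B) {r p q r' p' q' : ℤ}
    (hr : r = r') (hp : p = p') (hq : q = q') (x : A.E r p q) :
    φ.f r' p' q' (A.castE hr hp hq x) = B.castE hr hp hq (φ.f r p q x) := by
  subst hr; subst hp; subst hq; rfl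

theorem FQSSHom.f_d {A B : FQSS} (φ : FQSSHom A B) (r p q : ℤ) (x : A.E r p q) :
    φ.f r (p + r) (q - r + 1) (A.d r p q x) = B.d r p q (φ.f r p q x) :=
  LinearMap.congr_fun (φ.comm r p q) x

theorem FQSSAux.mem_boundaries (S : FQSSAux) (r p q : ℤ) (x : S.E r p q) :
    x ∈ S.boundaries r p q ↔ ∃ y : S.E r (p - r) (q + r - 1),
      S.castE rfl (by ring) (by ring) (S.d r (p - r) (q + r - 1) y) = x := Iff.rfl

theorem FQSSAux.homologyMk_eq_zero (S : FQSSAux) (r p q : ℤ) (x : S.E r p q)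
    (hx : x ∈ S.cycles r p q) :
    S.homologyMk r p q x hx = 0 ↔ x ∈ S.boundaries r p q :=
  Submodule.Quotient.mk_eq_zero _

theorem FQSS.exists_rep (S : FQSS) (r p q : ℤ) (hr : 2 ≤ r) (y : S.E (r + 1) p q) :
    ∃ (x : S.E r p q) (hx : x ∈ S.cycles r p q),
      (S.next r p q hr).symm (S.homologyMk r p q x hx) = y := by
  obtain ⟨⟨x, hx⟩, h⟩ := Submodule.Quotient.mk_surjective _ (S.next r p q hr y)
  refine ⟨x, hx, ?_⟩
  rw [LinearEquiv.symm_apply_eq]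
  exact h

theorem FQSS.mem_cycles_bottom (S : FQSS) (r p : ℤ) (hr : 2 ≤ r) (x : S.E r p 0) :
    x ∈ S.cycles r p 0 :=
  LinearMap.mem_ker.2 (S.firstQuadrant r (p + r) (0 - r + 1) (Or.inr (by linarith)) _)

theorem FQSS.edgeStep_apply (S : FQSS) (r p : ℤ) (hr : 2 ≤ r) (x : S.E r p 0) :
    S.edgeStep r p hr x =
      (S.next r p 0 hr).symm (S.homologyMk r p 0 x (S.mem_cycles_bottom r p hr x)) := rfl

theorem FQSS.edgeStep_eq_zero (S : FQSS) (r p : ℤ) (hr : 2 ≤ r) (x : S.E r p 0) :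
    S.edgeStep r p hr x = 0 ↔ x ∈ S.boundaries r p 0 := by
  rw [S.edgeStep_apply, LinearEquiv.map_eq_zero_iff, FQSSAux.homologyMk_eq_zero]

theorem FQSS.edgeStep_surjective (S : FQSS) (r p : ℤ) (hr : 2 ≤ r) :
    Function.Surjective (S.edgeStep r p hr) := by
  intro y
  obtain ⟨x, hx, h⟩ := S.exists_rep r p 0 hr y
  exact ⟨x, h⟩

theorem FQSSHom.f_edgeStep {A B : FQSS} (φ : FQSSHom A B) (r p : ℤ) (hr : 2 ≤ r)
    (x : A.E r p 0) :
    φ.f (r + 1) p 0 (A.edgeStep r p hr x) = B.edgeStep r p hr (φ.f r p 0 x) :=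
  φ.compat r p 0 hr x _

theorem FQSS.edgeFromNat_succ_apply (S : FQSS) (p : ℤ) (m : ℕ) (x : S.E 2 p 0) :
    S.edgeFromNat p (m + 1) x = S.castE (by push_cast; ring) rfl rfl
      (S.edgeStep (2 + (m : ℤ)) p (by omega) (S.edgeFromNat p m x)) := rfl

theorem FQSS.edgeFromNat_surjective (S : FQSS) (p : ℤ) (m : ℕ) :
    Function.Surjective (S.edgeFromNat p m) := by
  induction m with
  | zero => exact (S.castE _ rfl rfl).surjective
  | succ m ih =>
    exact (S.castE (by push_cast; ring) rfl rfl).surjective.comp ((S.edgeStep_surjective _ p _).comp ih)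

theorem FQSSHom.f_edgeFromNat {A B : FQSS} (φ : FQSSHom A B) (p : ℤ) (m : ℕ)
    (x : A.E 2 p 0) :
    φ.f (2 + (m : ℤ)) p 0 (A.edgeFromNat p m x) = B.edgeFromNat p m (φ.f 2 p 0 x) := by
  induction m with
  | zero => exact φ.f_castE _ _ _ x
  | succ m ih =>
    rw [FQSS.edgeFromNat_succ_apply, FQSS.edgeFromNat_succ_apply, φ.f_castE,
      φ.f_edgeStep, ih]

/-- Surjectivity in total degree `k` and injectivity in total degree `k + 1` propagate. -/
theorem FQSSHom.propagate {A B : FQSS} (φ : FQSSHom A B) (k : ℤ)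
    (hsurj : ∀ p q : ℤ, p + q = k → 1 ≤ p → p ≤ k - 1 → Function.Surjective (φ.f 2 p q))
    (hinj : ∀ p q : ℤ, p + q = k + 1 → 2 ≤ p → Function.Injective (φ.f 2 p q))
    (r : ℤ) (hr : 2 ≤ r) :
    (∀ p q : ℤ, p + q = k → 1 ≤ p → p ≤ k + 1 - r → Function.Surjective (φ.f r p q)) ∧
    (∀ p q : ℤ, p + q = k + 1 → r ≤ p → Function.Injective (φ.f r p q)) := by
  induction r, hr using Int.leInduction with
  | base => exact ⟨fun p q h h1 h2 => hsurj p q h h1 (by linarith), hinj⟩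
  | succ r hr ih =>
    obtain ⟨ihs, ihi⟩ := ih
    constructor
    · intro p q h h1 h2 y
      obtain ⟨y, hy, rfl⟩ := B.exists_rep r p q hr y
      obtain ⟨x, rfl⟩ := ihs p q h h1 (by linarith) y
      have hx : x ∈ A.cycles r p q := by
        refine LinearMap.mem_ker.2 (ihi (p + r) (q - r + 1) (by linarith) (by linarith) ?_)
        rw [map_zero, φ.f_d]
        exact hy
      exact ⟨_, φ.compat r p q hr x hx⟩
    · intro p q h h1
      by_cases hq : q < 0
      · intro a b _
        rw [A.firstQuadrant _ _ _ (Or.inr hq) a, A.firstQuadrant _ _ _ (Or.inr hq) b]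
      rw [injective_iff_map_eq_zero]
      intro x hx0
      obtain ⟨x, hx, rfl⟩ := A.exists_rep r p q hr x
      rw [φ.compat, LinearEquiv.map_eq_zero_iff, FQSSAux.homologyMk_eq_zero,
        FQSSAux.mem_boundaries] at hx0
      obtain ⟨y, hy⟩ := hx0
      obtain ⟨z, rfl⟩ := ihs (p - r) (q + r - 1) (by linarith) (by linarith) (by linarith) y
      rw [LinearEquiv.map_eq_zero_iff, FQSSAux.homologyMk_eq_zero, FQSSAux.mem_boundaries]
      refine ⟨z, ihi p q h (by linarith) ?_⟩
      rw [φ.f_castE, φ.f_d, hy]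

theorem FQSSHom.mem_range_of_edge {A B : FQSS} (φ : FQSSHom A B) (k : ℤ) (m : ℕ)
    (hs : ∀ r p q : ℤ, 2 ≤ r → p + q = k → 1 ≤ p → p ≤ k + 1 - r →
      Function.Surjective (φ.f r p q))
    (hm : 2 + (m : ℤ) ≤ k + 1) (x : B.E 2 (k + 1) 0)
    (hx : B.edgeFromNat (k + 1) m x = 0) :
    x ∈ LinearMap.range (φ.f 2 (k + 1) 0) := by
  induction m generalizing x with
  | zero =>
    have : x = 0 := (LinearEquiv.map_eq_zero_iff (B.castE _ rfl rfl)).1 hx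
    rw [this]; exact zero_mem _
  | succ m ih =>
    push_cast at hm
    rw [FQSS.edgeFromNat_succ_apply, LinearEquiv.map_eq_zero_iff, FQSS.edgeStep_eq_zero,
      FQSSAux.mem_boundaries] at hx
    obtain ⟨y, hy⟩ := hx
    obtain ⟨z, rfl⟩ := hs _ _ _ (by omega) (by ring) (by linarith) (by linarith) y
    rw [← φ.f_d, ← φ.f_castE] at hy
    obtain ⟨a, ha⟩ := A.edgeFromNat_surjective (k + 1) m
      (A.castE rfl (by ring) (by ring) (A.d _ _ _ z))
    rw [← ha, φ.f_edgeFromNat] at hy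
    have := ih (by linarith) (x - φ.f 2 (k + 1) 0 a) (by rw [map_sub, hy, sub_self])
    have h2 := add_mem this (LinearMap.mem_range_self (φ.f 2 (k + 1) 0) a)
    rwa [sub_add_cancel] at h2

theorem statement_11 (A B : FQSS) (φ : FQSSHom A B) (k : ℤ) (hk : 1 ≤ k)
    (hA : ∀ x : A.E (k + 1) (k + 1) 0, x = 0)
    (hsurj : ∀ p : ℤ, 1 ≤ p → p ≤ k - 1 → Function.Surjective (φ.f 2 p (k - p)))
    (hinj : ∀ p : ℤ, 2 ≤ p → Function.Injective (φ.f 2 p (k + 1 - p))) :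
    Function.Injective (φ.f 2 (k + 1) 0) ∧
    Function.Surjective (B.edge (k + 1) (k + 1) (by linarith)) ∧
    LinearMap.ker (B.edge (k + 1) (k + 1) (by linarith)) =
      LinearMap.range (φ.f 2 (k + 1) 0) := by
  have hs2 : ∀ p q : ℤ, p + q = k → 1 ≤ p → p ≤ k - 1 →
      Function.Surjective (φ.f 2 p q) := by
    intro p q h h1 h2
    obtain rfl : q = k - p := by linarith
    exact hsurj p h1 h2
  have hi2 : ∀ p q : ℤ, p + q = k + 1 → 2 ≤ p → Function.Injective (φ.f 2 p q) := by
    intro p q h h1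
    obtain rfl : q = k + 1 - p := by linarith
    exact hinj p h1
  refine ⟨hi2 _ _ (by ring) (by linarith), ?_, ?_⟩
  · exact (B.castE _ rfl rfl).surjective.comp (B.edgeFromNat_surjective _ _)
  · ext x
    constructor
    · intro hx
      refine φ.mem_range_of_edge k (k + 1 - 2).toNat
        (fun r p q hr => (φ.propagate k hs2 hi2 r hr).1 p q) (by omega) x ?_
      exact (LinearEquiv.map_eq_zero_iff (B.castE _ rfl rfl)).1 hx
    · rintro ⟨a, rfl⟩
      rw [LinearMap.mem_ker]
      change B.castE _ rfl rfl (B.edgeFromNat (k + 1) (k + 1 - 2).toNat _) = 0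
      rw [← φ.f_edgeFromNat, ← φ.f_castE]
      rw [hA (A.castE _ rfl rfl _), map_zero]
end
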